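/- There exist constants c > 0 and C ≥ 0 such that every finite set A of real numbers with |A| ≥ 2 contains a bi-Sidon subset S ⊆ A with |S| ≥ c · |A|^{11/26} · (log |A|)^{−C}. (Note 11/26 = 1/3 + 7/78.) -/

import Mathlib

/-- A set is additive Sidon if all pairwise sums are distinct. -/
def IsAddSidon {α : Type*} [Add α] (S : Set α) : Prop :=
  ∀ a ∈ S, ∀ b ∈ S, ∀ a' ∈ S, ∀ b' ∈ S, a + b = a' + b' → ({a, b} : Set α) = {a', b'}

/-- A set is multiplicative Sidon if all pairwise products are distinct. -/
def IsMulSidon {α : Type*} [Mul α] (S : Set α) : Prop :=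
  ∀ a ∈ S, ∀ b ∈ S, ∀ a' ∈ S, ∀ b' ∈ S, a * b = a' * b' → ({a, b} : Set α) = {a', b'}

/-- A set is bi-Sidon if it is both additive and multiplicative Sidon. -/
def IsBiSidon {α : Type*} [Add α] [Mul α] (S : Set α) : Prop :=
  IsAddSidon S ∧ IsMulSidon S

open Finset

/-- A layer-cake bound with logarithmic loss. -/
lemma sum_pow_le_of_level_le {ι : Type*} (s : Finset ι) (f : ι → ℕ) (n k : ℕ)
    (hf : ∀ i ∈ s, f i ≤ n) (hk : 1 ≤ k) (M : ℝ) (hM0 : 0 ≤ M)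
    (hM : ∀ t : ℕ, 1 ≤ t → t ≤ n → (t : ℝ) ^ k * #{i ∈ s | t ≤ f i} ≤ M) :
    ∑ i ∈ s, (f i : ℝ) ^ k ≤ k * (1 + Real.log n) * M := by
  have key : ∀ m : ℕ, (m : ℝ) ^ k ≤ ∑ t ∈ Icc 1 m, (k : ℝ) * (t : ℝ) ^ (k - 1) := by
    intro m
    induction m with
    | zero => simp [show k ≠ 0 by omega]
    | succ m ih =>
      rw [Finset.sum_Icc_succ_top (by omega)]
      have : ((m + 1 : ℕ) : ℝ) ^ k - (m : ℝ) ^ k ≤ k * ((m + 1 : ℕ) : ℝ) ^ (k - 1) := by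
        have h := geom_sum₂_mul ((m : ℝ) + 1) (m : ℝ) k
        have h1 : ∑ i ∈ range k, ((m : ℝ) + 1) ^ i * (m : ℝ) ^ (k - 1 - i)
            ≤ ∑ i ∈ range k, ((m : ℝ) + 1) ^ (k - 1) := by
          refine sum_le_sum fun i hi => ?_
          have hi' : i ≤ k - 1 := by have := mem_range.1 hi; omega
          calc ((m : ℝ) + 1) ^ i * (m : ℝ) ^ (k - 1 - i)
              ≤ ((m : ℝ) + 1) ^ i * ((m : ℝ) + 1) ^ (k - 1 - i) := by gcongr; linarith
            _ = _ := by rw [← pow_add]; congr 1; omega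
        simp only [sum_const, card_range, nsmul_eq_mul] at h1
        push_cast
        nlinarith
      linarith
  calc ∑ i ∈ s, (f i : ℝ) ^ k
      ≤ ∑ i ∈ s, ∑ t ∈ Icc 1 (f i), (k : ℝ) * (t : ℝ) ^ (k - 1) := sum_le_sum fun i _ => key _
    _ = ∑ i ∈ s, ∑ t ∈ Icc 1 n, if t ≤ f i then (k : ℝ) * (t : ℝ) ^ (k - 1) else 0 := by
        refine sum_congr rfl fun i hi => ?_
        rw [← sum_filter]
        refine sum_congr ?_ fun _ _ => rfl
        ext t
        have := hf i hi
        simp only [mem_Icc, mem_filter]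
        omega
    _ = ∑ t ∈ Icc 1 n, (k : ℝ) * (t : ℝ) ^ (k - 1) * #{i ∈ s | t ≤ f i} := by
        rw [sum_comm]
        refine sum_congr rfl fun t _ => ?_
        rw [← sum_filter, sum_const, nsmul_eq_mul, mul_comm]
    _ ≤ ∑ t ∈ Icc 1 n, (k : ℝ) * M * (t : ℝ)⁻¹ := by
        refine sum_le_sum fun t ht => ?_
        obtain ⟨h1, h2⟩ := mem_Icc.1 ht
        have ht0 : (0 : ℝ) < t := by exact_mod_cast h1
        have := hM t h1 h2
        rw [← div_eq_mul_inv, le_div_iff₀ ht0]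
        have e : (t : ℝ) ^ k = (t : ℝ) ^ (k - 1) * t := by rw [← pow_succ]; congr 1; omega
        rw [e] at this
        have hk0 : (0 : ℝ) ≤ k := by positivity
        nlinarith
    _ = k * (harmonic n : ℝ) * M := by
        rw [← mul_sum, harmonic_eq_sum_Icc]; push_cast; ring
    _ ≤ k * (1 + Real.log n) * M := by
        have := harmonic_le_one_add_log n
        gcongr

/-- Pigeonholing over level sets: some level set carries the power sum up to a logarithm. -/
lemma exists_level {ι : Type*} (s : Finset ι) (f : ι → ℕ) (n k : ℕ)
    (hf : ∀ i ∈ s, f i ≤ n) (hk : 1 ≤ k) {l : ℝ} (hl : 1 + Real.log n ≤ l)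
    (hpos : 0 < ∑ i ∈ s, (f i : ℝ) ^ k) :
    ∃ t : ℕ, 1 ≤ t ∧ t ≤ n ∧
      ∑ i ∈ s, (f i : ℝ) ^ k ≤ k * l * ((t : ℝ) ^ k * #{i ∈ s | t ≤ f i}) := by
  have hn : 1 ≤ n := by
    by_contra h
    have h0 : ∀ i ∈ s, (f i : ℝ) ^ k = 0 := fun i hi => by
      have := hf i hi
      have : f i = 0 := by omega
      simp [this, show k ≠ 0 by omega]
    rw [sum_congr rfl h0] at hpos
    simp at hpos
  obtain ⟨t, ht, hmax⟩ := exists_max_image (Icc 1 n)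
    (fun t : ℕ => (t : ℝ) ^ k * #{i ∈ s | t ≤ f i}) ⟨1, by simp [hn]⟩
  obtain ⟨h1, h2⟩ := mem_Icc.1 ht
  refine ⟨t, h1, h2, ?_⟩
  refine (sum_pow_le_of_level_le s f n k hf hk _ (by positivity)
    fun u hu hu' => hmax u (mem_Icc.2 ⟨hu, hu'⟩)).trans ?_
  gcongr

/-- Incidences between the grid `U × V` and lines `v = c * u - q`, indexed by `(c, q)`. -/
noncomputable def incidences (U V : Finset ℝ) (L : Finset (ℝ × ℝ)) : Finset ((ℝ × ℝ) × ℝ) :=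
  {x ∈ L ×ˢ U | x.1.1 * x.2 - x.1.2 ∈ V}

lemma exists_blocks (U : Finset ℝ) {k : ℕ} (hk : 1 ≤ k) :
    ∃ α : ℝ → ℕ, Monotone α ∧ (∀ u ∈ U, α u ≤ #U / k) ∧ ∀ i, #{u ∈ U | α u = i} ≤ k := by
  have hmono : Monotone fun u : ℝ => #{x ∈ U | x < u} := fun u v huv =>
    card_le_card fun x hx => by
      simp only [mem_filter] at hx ⊢
      exact ⟨hx.1, hx.2.trans_le huv⟩
  have hstrict : ∀ u ∈ U, ∀ v, u < v → #{x ∈ U | x < u} < #{x ∈ U | x < v} := fun u hu v huv => by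
    refine card_lt_card ⟨fun x hx => ?_, fun h => ?_⟩
    · simp only [mem_filter] at hx ⊢
      exact ⟨hx.1, hx.2.trans huv⟩
    · have : u ∈ ({x ∈ U | x < u} : Finset ℝ) := h (by simp [hu, huv])
      simp at this
  refine ⟨fun u => #{x ∈ U | x < u} / k, fun u v huv => Nat.div_le_div_right (hmono huv),
    fun u _ => Nat.div_le_div_right (card_le_card (filter_subset _ _)), fun i => ?_⟩
  have : #{u ∈ U | #{x ∈ U | x < u} / k = i} ≤ #(Ico (i * k) (i * k + k)) := by
    refine card_le_card_of_injOn (fun u => #{x ∈ U | x < u}) (fun u hu => ?_) ?_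
    · have hu := (mem_filter.1 hu).2
      rw [Nat.div_eq_iff (by omega)] at hu
      simp only [coe_Ico, Set.mem_Ico]
      omega
    · intro u hu v hv huv
      have hu := (mem_filter.1 hu).1
      have hv := (mem_filter.1 hv).1
      rcases lt_trichotomy u v with h | h | h
      · exact absurd huv (hstrict u hu v h).ne
      · exact h
      · exact absurd huv (hstrict v hv u h).ne'
  simpa using this

lemma card_incidences_eq_sum (U V : Finset ℝ) (L : Finset (ℝ × ℝ)) :
    #(incidences U V L) = ∑ p ∈ L, #{u ∈ U | p.1 * u - p.2 ∈ V} := by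
  rw [incidences, card_filter, sum_product]
  simp only [card_filter]

lemma card_incidences_le_cells (U V : Finset ℝ) (L : Finset (ℝ × ℝ)) (hL : ∀ p ∈ L, 0 < p.1)
    {k l : ℕ} (hk : 1 ≤ k) (hl : 1 ≤ l) :
    #(incidences U V L) ≤ #L * (#U / k + #V / l + 1) + #U * k * (#V * l) := by
  obtain ⟨α, hα, hαU, hαk⟩ := exists_blocks U hk
  obtain ⟨β, hβ, hβV, hβl⟩ := exists_blocks V hl
  set F : ℝ × ℝ → Finset ℝ := fun p => {u ∈ U | p.1 * u - p.2 ∈ V} with hF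
  set D : ℝ × ℝ → Finset (ℝ × ℝ) := fun p => {x ∈ F p ×ˢ F p | x.1 ≠ x.2 ∧ α x.1 = α x.2 ∧
    β (p.1 * x.1 - p.2) = β (p.1 * x.2 - p.2)} with hD
  have hline : ∀ p ∈ L, #(F p) ≤ (#U / k + #V / l + 1) + #(D p) := by
    intro p hp
    set φ : ℝ → ℕ := fun u => α u + β (p.1 * u - p.2) with hφ
    have hmono2 : Monotone fun u => β (p.1 * u - p.2) := fun u v huv =>
      hβ (by have := hL p hp; nlinarith)
    have hmap : ∀ u ∈ F p, φ u ∈ range (#U / k + #V / l + 1) := fun u hu => by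
      have hu := mem_filter.1 hu
      have h1 := hαU u hu.1
      have h2 := hβV _ hu.2
      simp only [hφ, mem_range]; omega
    rw [card_eq_sum_card_fiberwise hmap]
    have h1 : ∀ j ∈ range (#U / k + #V / l + 1), #{u ∈ F p | φ u = j} ≤
        1 + #{x ∈ D p | φ x.1 = j} := by
      intro j _
      have h2 : #({u ∈ F p | φ u = j} : Finset ℝ).offDiag ≤ #{x ∈ D p | φ x.1 = j} := by
        refine card_le_card fun x hx => ?_
        simp only [mem_offDiag, mem_filter, hD, mem_product, hφ] at hx ⊢
        obtain ⟨⟨hx1, e1⟩, ⟨hx2, e2⟩, hne⟩ := hx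
        refine ⟨⟨⟨hx1, hx2⟩, hne, ?_⟩, e1⟩
        rcases le_total x.1 x.2 with h | h
        · have a1 := hα h
          have a2 := hmono2 h
          simp only at a2
          omega
        · have a1 := hα h
          have a2 := hmono2 h
          simp only at a2
          omega
      rw [offDiag_card] at h2
      generalize #{u ∈ F p | φ u = j} = q at h2 ⊢
      rcases q with _ | _ | q
      · omega
      · omega
      · have : (q + 1 + 1) * (q + 1 + 1) - (q + 1 + 1) = (q + 2) * (q + 1) := by
          have : (q + 1 + 1) * (q + 1 + 1) = (q + 2) * (q + 1) + (q + 2) := by ring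
          omega
        nlinarith
    refine (sum_le_sum h1).trans ?_
    rw [sum_add_distrib, ← card_eq_sum_card_fiberwise (s := D p) (f := fun x => φ x.1)]
    · simp
    · intro x hx
      exact hmap _ (mem_product.1 (mem_filter.1 hx).1).1
  have hpairs : ∑ p ∈ L, #(D p) ≤ #U * k * (#V * l) := by
    rw [← card_sigma]
    have hcount : ∀ (W : Finset ℝ) (γ : ℝ → ℕ) (r : ℕ), (∀ i, #{u ∈ W | γ u = i} ≤ r) →
        #{x ∈ W ×ˢ W | γ x.1 = γ x.2} ≤ #W * r := by
      intro W γ r h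
      rw [card_filter, sum_product, ← smul_eq_mul, ← sum_const]
      refine sum_le_sum fun u _ => ?_
      rw [← card_filter]
      refine le_trans (card_le_card fun v hv => ?_) (h (γ u))
      simp only [mem_filter] at hv ⊢
      exact ⟨hv.1, hv.2.symm⟩
    refine le_trans ?_ (Nat.mul_le_mul (hcount U α k hαk) (hcount V β l hβl))
    rw [← card_product]
    refine card_le_card_of_injOn (fun y => (y.2, (y.1.1 * y.2.1 - y.1.2, y.1.1 * y.2.2 - y.1.2)))
      ?_ ?_
    · rintro ⟨p, x⟩ hy
      simp only [coe_sigma, Set.mem_sigma_iff, mem_coe, hD, hF, mem_filter, mem_product] at hy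
      simp only [coe_product, Set.mem_prod, mem_coe, mem_filter, mem_product]
      tauto
    · rintro ⟨p, x⟩ hy ⟨p', x'⟩ hy' h
      simp only [coe_sigma, Set.mem_sigma_iff, mem_coe, hD, mem_filter] at hy
      simp only [Prod.mk.injEq] at h
      obtain ⟨rfl, h1, h2⟩ := h
      have hne : x.1 - x.2 ≠ 0 := sub_ne_zero.2 hy.2.2.1
      have : p.1 = p'.1 := by
        apply mul_right_cancel₀ hne
        linarith
      have h3 : p.2 = p'.2 := by rw [this] at h1; linarith
      rw [Prod.ext this h3]
  rw [card_incidences_eq_sum]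
  refine (sum_le_sum hline).trans ?_
  rw [sum_add_distrib, sum_const, smul_eq_mul]
  gcongr

lemma card_incidences_le_left (U V : Finset ℝ) (L : Finset (ℝ × ℝ)) :
    #(incidences U V L) ≤ #L * #U := by
  rw [← card_product]; exact card_le_card (filter_subset _ _)

lemma card_incidences_le_right (U V : Finset ℝ) (L : Finset (ℝ × ℝ)) (hL : ∀ p ∈ L, 0 < p.1) :
    #(incidences U V L) ≤ #L * #V := by
  rw [card_incidences_eq_sum, ← smul_eq_mul, ← sum_const]
  refine sum_le_sum fun p hp => card_le_card_of_injOn (fun u => p.1 * u - p.2) (fun u hu => ?_) ?_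
  · exact (mem_filter.1 hu).2
  · intro u _ v _ h
    have := (hL p hp).ne'
    simp only at h
    exact mul_left_cancel₀ this (by linarith)

lemma exists_cube_root {x : ℝ} (hx : 0 ≤ x) : ∃ y : ℝ, 0 ≤ y ∧ y ^ 3 = x :=
  ⟨x ^ (1 / 3 : ℝ), by positivity, by
    rw [← Real.rpow_natCast, ← Real.rpow_mul hx]; norm_num⟩

/-- The Szemerédi–Trotter bound for Cartesian products and increasing lines. -/
theorem card_incidences_pow_three_le (U V : Finset ℝ) (L : Finset (ℝ × ℝ))
    (hL : ∀ p ∈ L, 0 < p.1) :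
    (#(incidences U V L) : ℝ) ^ 3 ≤ 343 * (((#U : ℝ) * #V * #L) ^ 2 + (#L : ℝ) ^ 3) := by
  set a : ℝ := (#U : ℝ) with ha
  set b : ℝ := (#V : ℝ) with hb
  set m : ℝ := (#L : ℝ) with hm
  set J : ℝ := (#(incidences U V L) : ℝ) with hJ
  have hJ0 : 0 ≤ J := by positivity
  have ha0 : 0 ≤ a := by positivity
  have hb0 : 0 ≤ b := by positivity
  have h1 : J ≤ m * a := by
    rw [hJ, hm, ha]; exact_mod_cast card_incidences_le_left U V L
  have h2 : J ≤ m * b := by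
    rw [hJ, hm, hb]; exact_mod_cast card_incidences_le_right U V L hL
  have hm0 : 0 ≤ m := by positivity
  rcases hm0.eq_or_lt with hm' | hm'
  · have : J = 0 := le_antisymm (by rw [← hm'] at h1; linarith) hJ0
    rw [this, zero_pow three_ne_zero]; positivity
  obtain ⟨ρ, hρ0, hρ⟩ := exists_cube_root (x := (a * b) ^ 2 / m) (by positivity)
  have hρm : m * ρ ^ 3 = (a * b) ^ 2 := by rw [hρ]; field_simp
  have key : J ≤ m * (6 * ρ + 1) := by
    rcases le_or_gt a ρ with haρ | haρ
    · nlinarith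
    rcases le_or_gt b ρ with hbρ | hbρ
    · nlinarith
    have ha' : 0 < a := hρ0.trans_lt haρ
    have hb' : 0 < b := hρ0.trans_lt hbρ
    have hρ' : 0 < ρ := by
      rcases hρ0.eq_or_lt with h | h
      · rw [← h] at hρm
        have : 0 < (a * b) ^ 2 := by positivity
        have : m * (0 : ℝ) ^ 3 = 0 := by ring
        linarith
      · exact h
    set k := ⌈a / ρ⌉₊
    set l := ⌈b / ρ⌉₊
    have hk1 : a / ρ ≤ k := Nat.le_ceil _
    have hl1 : b / ρ ≤ l := Nat.le_ceil _
    have hk0 : 0 < k := Nat.ceil_pos.2 (by positivity)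
    have hl0 : 0 < l := Nat.ceil_pos.2 (by positivity)
    have hk2 : (k : ℝ) ≤ 2 * (a / ρ) := by
      have := Nat.ceil_lt_add_one (show 0 ≤ a / ρ by positivity)
      have : 1 ≤ a / ρ := by rw [one_le_div hρ']; exact haρ.le
      linarith
    have hl2 : (l : ℝ) ≤ 2 * (b / ρ) := by
      have := Nat.ceil_lt_add_one (show 0 ≤ b / ρ by positivity)
      have : 1 ≤ b / ρ := by rw [one_le_div hρ']; exact hbρ.le
      linarith
    have h := card_incidences_le_cells U V L hL hk0 hl0
    have h' : J ≤ m * (((#U / k : ℕ) : ℝ) + ((#V / l : ℕ) : ℝ) + 1) + a * k * (b * l) := by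
      rw [hJ, hm, ha, hb]; exact_mod_cast h
    have hA : ((#U / k : ℕ) : ℝ) ≤ ρ := by
      refine Nat.cast_div_le.trans ?_
      rw [div_le_iff₀ (by exact_mod_cast hk0), ← div_le_iff₀' hρ']
      exact hk1
    have hB : ((#V / l : ℕ) : ℝ) ≤ ρ := by
      refine Nat.cast_div_le.trans ?_
      rw [div_le_iff₀ (by exact_mod_cast hl0), ← div_le_iff₀' hρ']
      exact hl1
    have hC : a * k * (b * l) ≤ 4 * (m * ρ) := by
      calc a * k * (b * l) ≤ a * (2 * (a / ρ)) * (b * (2 * (b / ρ))) := by gcongr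
        _ = 4 * ((a * b) ^ 2 / ρ ^ 2) := by field_simp; ring
        _ = 4 * (m * ρ) := by rw [← hρm]; field_simp
    calc J ≤ _ := h'
      _ ≤ m * (ρ + ρ + 1) + 4 * (m * ρ) := by gcongr
      _ = m * (6 * ρ + 1) := by ring
  have hfin : (6 * ρ + 1) ^ 3 ≤ 343 * (ρ ^ 3 + 1) := by
    nlinarith [sq_nonneg (ρ - 1), mul_nonneg hρ0 (sq_nonneg (ρ - 1)), pow_nonneg hρ0 3]
  calc J ^ 3 ≤ (m * (6 * ρ + 1)) ^ 3 := by gcongr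
    _ = m ^ 3 * (6 * ρ + 1) ^ 3 := by ring
    _ ≤ m ^ 3 * (343 * (ρ ^ 3 + 1)) := by gcongr
    _ = 343 * (m ^ 2 * (m * ρ ^ 3) + m ^ 3) := by ring
    _ = 343 * ((a * b * m) ^ 2 + m ^ 3) := by rw [hρm]; ring

/-- The number of representations `x = b - c` with `b ∈ B`, `c ∈ C`. -/
noncomputable def diffRep (B C : Finset ℝ) (x : ℝ) : ℕ := #{p ∈ B ×ˢ C | p.1 - p.2 = x}

/-- The differences having at least `t` representations. -/
noncomputable def popularDiff (B : Finset ℝ) (t : ℕ) : Finset ℝ :=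
  {x ∈ (B ×ˢ B).image fun p => p.1 - p.2 | t ≤ diffRep B B x}

/-- `B` is controlled: `b - c ∈ X` has few solutions, uniformly in `C` and `X`. -/
def Controlled (K : ℝ) (B : Finset ℝ) : Prop :=
  ∀ C X : Finset ℝ, ∀ y : ℝ, 0 ≤ y → K * (#C : ℝ) ^ 2 * (#X : ℝ) ^ 2 ≤ y ^ 3 →
    (#{p ∈ B ×ˢ C | p.1 - p.2 ∈ X} : ℝ) ≤ #B * y

lemma Controlled.pow_three_le {K : ℝ} {B : Finset ℝ} (h : Controlled K B) (hK : 0 ≤ K)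
    (C X : Finset ℝ) :
    (#{p ∈ B ×ˢ C | p.1 - p.2 ∈ X} : ℝ) ^ 3 ≤ K * (#B : ℝ) ^ 3 * (#C : ℝ) ^ 2 * (#X : ℝ) ^ 2 := by
  obtain ⟨y, hy0, hy⟩ := exists_cube_root (x := K * (#C : ℝ) ^ 2 * (#X : ℝ) ^ 2) (by positivity)
  calc _ ≤ ((#B : ℝ) * y) ^ 3 := by gcongr; exact h C X y hy0 hy.ge
    _ = (#B : ℝ) ^ 3 * y ^ 3 := by ring
    _ = _ := by rw [hy]; ring

lemma controlled_of_pow_three_le {K : ℝ} {B : Finset ℝ}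
    (h : ∀ C X : Finset ℝ, (#{p ∈ B ×ˢ C | p.1 - p.2 ∈ X} : ℝ) ^ 3 ≤
      K * (#B : ℝ) ^ 3 * (#C : ℝ) ^ 2 * (#X : ℝ) ^ 2) : Controlled K B := by
  intro C X y hy hK
  refine le_of_pow_le_pow_left₀ three_ne_zero (by positivity) ((h C X).trans ?_)
  calc K * (#B : ℝ) ^ 3 * (#C : ℝ) ^ 2 * (#X : ℝ) ^ 2
      = (#B : ℝ) ^ 3 * (K * (#C : ℝ) ^ 2 * (#X : ℝ) ^ 2) := by ring
    _ ≤ (#B : ℝ) ^ 3 * y ^ 3 := by gcongr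
    _ = _ := by ring

lemma Controlled.union {K : ℝ} {B B' : Finset ℝ} (h : Controlled K B) (h' : Controlled K B')
    (hd : Disjoint B B') : Controlled K (B ∪ B') := by
  intro C X y hy hK
  rw [card_union_of_disjoint hd, union_product, filter_union]
  calc _ ≤ (#{p ∈ B ×ˢ C | p.1 - p.2 ∈ X} : ℝ) + #{p ∈ B' ×ˢ C | p.1 - p.2 ∈ X} := by
        exact_mod_cast card_union_le _ _
    _ ≤ #B * y + #B' * y := add_le_add (h C X y hy hK) (h' C X y hy hK)
    _ = _ := by push_cast; ring

lemma controlled_empty (K : ℝ) : Controlled K ∅ := by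
  intro C X y hy hK
  simp

/-- The incidence estimate through which popularity of `g`-differences controls `f`-differences. -/
def IncidenceBound (f g : ℝ → ℝ) : Prop :=
  ∀ B P C X : Finset ℝ, (∀ b ∈ B, 0 < b) →
    (#{z ∈ (B ×ˢ B) ×ˢ C | g z.1.1 - g z.1.2 ∈ P ∧ f z.1.1 - z.2 ∈ X} : ℝ) ^ 3 ≤
      343 * (((#B : ℝ) * #X * (#P * #C)) ^ 2 + ((#P : ℝ) * #C) ^ 3)

lemma incidenceBound_id_log : IncidenceBound id Real.log := by
  intro B P C X hB
  set L : Finset (ℝ × ℝ) := P.image Real.exp ×ˢ C with hL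
  have hcard : (#L : ℝ) ≤ (#P : ℝ) * #C := by
    rw [hL, card_product]; push_cast
    exact mul_le_mul_of_nonneg_right (by exact_mod_cast card_image_le) (by positivity)
  have hle : #{z ∈ (B ×ˢ B) ×ˢ C | Real.log z.1.1 - Real.log z.1.2 ∈ P ∧ id z.1.1 - z.2 ∈ X} ≤
      #(incidences B X L) := by
    refine card_le_card_of_injOn (fun z => ((z.1.1 / z.1.2, z.2), z.1.2)) ?_ ?_
    · rintro ⟨⟨b, a⟩, c⟩ hz
      simp only [mem_coe, mem_filter, mem_product, id] at hz
      obtain ⟨⟨⟨hb, ha⟩, hc⟩, h1, h2⟩ := hz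
      have ha0 := hB a ha
      have hb0 := hB b hb
      simp only [incidences, hL, mem_coe, mem_filter, mem_product, mem_image]
      refine ⟨⟨⟨⟨_, h1, ?_⟩, hc⟩, ha⟩, ?_⟩
      · rw [← Real.log_div hb0.ne' ha0.ne', Real.exp_log (by positivity)]
      · rwa [div_mul_cancel₀ _ ha0.ne']
    · rintro ⟨⟨b, a⟩, c⟩ hz ⟨⟨b', a'⟩, c'⟩ hz' h
      simp only [mem_coe, mem_filter, mem_product, id] at hz hz'
      have ha0 := hB a hz.1.1.2
      simp only [Prod.mk.injEq] at h ⊢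
      obtain ⟨⟨h1, rfl⟩, rfl⟩ := h
      refine ⟨⟨?_, rfl⟩, rfl⟩
      field_simp at h1
      exact h1
  calc _ ≤ (#(incidences B X L) : ℝ) ^ 3 := by gcongr
    _ ≤ 343 * (((#B : ℝ) * #X * #L) ^ 2 + (#L : ℝ) ^ 3) :=
        card_incidences_pow_three_le B X L fun p hp => by
          obtain ⟨x, -, hx⟩ := mem_image.1 (mem_product.1 hp).1
          rw [← hx]; exact Real.exp_pos x
    _ ≤ _ := by gcongr

lemma incidenceBound_log_id : IncidenceBound Real.log id := by
  intro B P C X hB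
  set L : Finset (ℝ × ℝ) := C.image Real.exp ×ˢ P with hL
  have hcard : (#L : ℝ) ≤ #P * #C := by
    rw [hL, card_product, mul_comm]; push_cast
    exact mul_le_mul_of_nonneg_left (by exact_mod_cast card_image_le) (by positivity)
  have hX : (#(X.image Real.exp) : ℝ) ≤ #X := by exact_mod_cast card_image_le
  have hle : #{z ∈ (B ×ˢ B) ×ˢ C | id z.1.1 - id z.1.2 ∈ P ∧ Real.log z.1.1 - z.2 ∈ X} ≤
      #(incidences (X.image Real.exp) B L) := by
    refine card_le_card_of_injOn
      (fun z => ((Real.exp z.2, z.1.1 - z.1.2), Real.exp (Real.log z.1.1 - z.2))) ?_ ?_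
    · rintro ⟨⟨b, a⟩, c⟩ hz
      simp only [mem_coe, mem_filter, mem_product, id] at hz
      obtain ⟨⟨⟨hb, ha⟩, hc⟩, h1, h2⟩ := hz
      simp only [incidences, hL, mem_coe, mem_filter, mem_product, mem_image]
      refine ⟨⟨⟨⟨_, hc, rfl⟩, h1⟩, ⟨_, h2, rfl⟩⟩, ?_⟩
      rw [← Real.exp_add, add_sub_cancel, Real.exp_log (hB b hb), sub_sub_cancel]
      exact ha
    · rintro ⟨⟨b, a⟩, c⟩ hz ⟨⟨b', a'⟩, c'⟩ hz' h
      simp only [mem_coe, mem_filter, mem_product, id] at hz hz'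
      have hb0 := hB b hz.1.1.1
      have hb0' := hB b' hz'.1.1.1
      simp only [Prod.mk.injEq, Real.exp_eq_exp] at h ⊢
      obtain ⟨⟨rfl, h1⟩, h2⟩ := h
      have : b = b' := Real.log_injOn_pos hb0 hb0' (by linarith)
      subst this
      exact ⟨⟨rfl, by linarith⟩, rfl⟩
  calc _ ≤ (#(incidences (X.image Real.exp) B L) : ℝ) ^ 3 := by gcongr
    _ ≤ 343 * (((#(X.image Real.exp) : ℝ) * #B * #L) ^ 2 + (#L : ℝ) ^ 3) :=
        card_incidences_pow_three_le _ _ L fun p hp => by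
          obtain ⟨x, -, hx⟩ := mem_image.1 (mem_product.1 hp).1
          rw [← hx]; exact Real.exp_pos x
    _ ≤ 343 * (((#X : ℝ) * #B * (#P * #C)) ^ 2 + ((#P : ℝ) * #C) ^ 3) := by gcongr
    _ = _ := by ring

lemma card_filter_image_prod {f : ℝ → ℝ} {B : Finset ℝ} (hf : Set.InjOn f B) (C X : Finset ℝ) :
    #{p ∈ B.image f ×ˢ C | p.1 - p.2 ∈ X} = #{p ∈ B ×ˢ C | f p.1 - p.2 ∈ X} := by
  symm
  refine card_bij (fun p _ => (f p.1, p.2)) ?_ ?_ ?_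
  · rintro ⟨b, c⟩ h
    simp only [mem_filter, mem_product, mem_image] at h ⊢
    exact ⟨⟨⟨b, h.1.1, rfl⟩, h.1.2⟩, h.2⟩
  · rintro ⟨b, c⟩ h ⟨b', c'⟩ h' e
    simp only [mem_filter, mem_product, Prod.mk.injEq] at h h' e ⊢
    exact ⟨hf h.1.1 h'.1.1 e.1, e.2⟩
  · rintro ⟨b, c⟩ h
    simp only [mem_filter, mem_product, mem_image] at h
    obtain ⟨⟨⟨a, ha, rfl⟩, hc⟩, hx⟩ := h
    exact ⟨(a, c), by simp [ha, hc, hx], rfl⟩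

lemma diffRep_image {g : ℝ → ℝ} {B : Finset ℝ} (hg : Set.InjOn g B) (x : ℝ) :
    diffRep (B.image g) (B.image g) x = #{p ∈ B ×ˢ B | g p.1 - g p.2 = x} := by
  symm
  refine card_bij (fun p _ => (g p.1, g p.2)) ?_ ?_ ?_
  · rintro ⟨b, c⟩ h
    simp only [mem_filter, mem_product, mem_image] at h ⊢
    exact ⟨⟨⟨b, h.1.1, rfl⟩, ⟨c, h.1.2, rfl⟩⟩, h.2⟩
  · rintro ⟨b, c⟩ h ⟨b', c'⟩ h' e
    simp only [mem_filter, mem_product, Prod.mk.injEq] at h h' e ⊢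
    exact ⟨hg h.1.1 h'.1.1 e.1, hg h.1.2 h'.1.2 e.2⟩
  · rintro ⟨b, c⟩ h
    simp only [mem_filter, mem_product, mem_image] at h
    obtain ⟨⟨⟨a, ha, rfl⟩, ⟨a', ha', rfl⟩⟩, hx⟩ := h
    exact ⟨(a, a'), by simp [ha, ha', hx], rfl⟩

/-- Many popular `g`-differences yield a nonempty piece controlled with respect to `f`. -/
lemma exists_controlled_piece {f g : ℝ → ℝ} (hfg : IncidenceBound f g) {B : Finset ℝ}
    (hB : ∀ b ∈ B, 0 < b) (hf : Set.InjOn f B) (hg : Set.InjOn g B) {N : ℕ} (hN : #B ≤ N) {l : ℝ}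
    (hl : 1 + Real.log N ≤ l) {t : ℕ} {T : ℝ} (hT : 0 < T)
    (hpop : T ≤ (t : ℝ) ^ 3 * #(popularDiff (B.image g) t)) :
    ∃ B' ⊆ B, B'.Nonempty ∧ Controlled (686 * l ^ 3 * N ^ 2 / T) (B'.image f) := by
  set P := popularDiff (B.image g) t with hP
  have hl0 : 0 < l := lt_of_lt_of_le (by have := Real.log_natCast_nonneg N; linarith) hl
  have ht0 : (0 : ℝ) < t := by
    rcases Nat.eq_zero_or_pos t with h | h
    · rw [h] at hpop; simp at hpop; linarith
    · exact_mod_cast h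
  have hP0 : (0 : ℝ) < #P := by
    rcases Nat.eq_zero_or_pos #P with h | h
    · rw [h] at hpop; simp at hpop; linarith
    · exact_mod_cast h
  set w : ℝ → ℕ := fun b => #{a ∈ B | g b - g a ∈ P} with hw
  have hwB : ∀ b, w b ≤ #B := fun b => card_le_card (filter_subset _ _)
  have hwP : ∀ b, w b ≤ #P := fun b => by
    refine card_le_card_of_injOn (fun a => g b - g a) (fun a ha => (mem_filter.1 ha).2) ?_
    intro a ha a' ha' h
    exact hg (mem_filter.1 ha).1 (mem_filter.1 ha').1 (by simp only at h; linarith)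
  have hsum : t * #P ≤ ∑ b ∈ B, w b := by
    have e : ∑ b ∈ B, w b = #{p ∈ B ×ˢ B | g p.1 - g p.2 ∈ P} := by
      rw [card_filter, sum_product]; simp only [hw, card_filter]
    rw [e, card_eq_sum_card_fiberwise (s := {p ∈ B ×ˢ B | g p.1 - g p.2 ∈ P}) (t := P)
      (f := fun p : ℝ × ℝ => g p.1 - g p.2)
      (fun p hp => (mem_filter.1 hp).2), mul_comm, ← smul_eq_mul, ← sum_const]
    refine sum_le_sum fun x hx => ?_
    have h1 : t ≤ diffRep (B.image g) (B.image g) x := (mem_filter.1 hx).2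
    rw [diffRep_image hg] at h1
    refine h1.trans (card_le_card fun p hp => ?_)
    simp only [mem_filter] at hp ⊢
    exact ⟨⟨hp.1, by rw [hp.2]; exact hx⟩, hp.2⟩
  have hsum' : (t : ℝ) * #P ≤ ∑ b ∈ B, (w b : ℝ) ^ 1 := by simp only [pow_one]; exact_mod_cast hsum
  obtain ⟨s, hs1, -, hs⟩ := exists_level B w N 1 (fun b _ => (hwB b).trans hN) le_rfl hl
    (lt_of_lt_of_le (by positivity) hsum')
  set B' : Finset ℝ := {b ∈ B | s ≤ w b} with hB'
  have hB'B : B' ⊆ B := filter_subset _ _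
  have hs' : (t : ℝ) * #P ≤ l * (s * #B') := by
    have := hsum'.trans hs
    simpa using this
  have hs0 : (0 : ℝ) < s := by exact_mod_cast hs1
  have hne : B'.Nonempty := by
    rw [nonempty_iff_ne_empty]
    intro h
    rw [h] at hs'
    simp at hs'
    nlinarith
  obtain ⟨b₀, hb₀⟩ := hne
  have hsB : (s : ℝ) ≤ #B := by exact_mod_cast (mem_filter.1 hb₀).2.trans (hwB b₀)
  have hsP : (s : ℝ) ≤ #P := by exact_mod_cast (mem_filter.1 hb₀).2.trans (hwP b₀)
  refine ⟨B', hB'B, ⟨b₀, hb₀⟩, controlled_of_pow_three_le fun C X => ?_⟩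
  rw [card_filter_image_prod (hf.mono (by exact_mod_cast hB'B)),
    card_image_of_injOn (hf.mono (by exact_mod_cast hB'B))]
  set S := #{p ∈ B' ×ˢ C | f p.1 - p.2 ∈ X} with hS
  set J := #{z ∈ (B ×ˢ B) ×ˢ C | g z.1.1 - g z.1.2 ∈ P ∧ f z.1.1 - z.2 ∈ X} with hJ
  have hJbound := hfg B P C X hB
  rw [← hJ] at hJbound
  have hsS : s * S ≤ J := by
    rw [hJ, card_eq_sum_card_fiberwise (t := {p ∈ B ×ˢ C | f p.1 - p.2 ∈ X})
      (f := fun z : (ℝ × ℝ) × ℝ => (z.1.1, z.2)), mul_comm, ← smul_eq_mul, ← sum_const]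
    · refine (sum_le_sum fun p hp => ?_).trans
        (sum_le_sum_of_subset (s := {p ∈ B' ×ˢ C | f p.1 - p.2 ∈ X}) ?_)
      · have hp := mem_filter.1 hp
        have hp1 := (mem_filter.1 (mem_product.1 hp.1).1)
        refine hp1.2.trans (card_le_card_of_injOn (fun a => ((p.1, a), p.2)) ?_ ?_)
        · intro a ha
          simp only [mem_coe, mem_filter, mem_product] at ha hp ⊢
          exact ⟨⟨⟨⟨hp1.1, ha.1⟩, hp.1.2⟩, ha.2, hp.2⟩, trivial⟩
        · intro a _ a' _ h
          simpa using h
      · exact filter_subset_filter _ (product_subset_product hB'B subset_rfl)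
    · intro z hz
      simp only [mem_coe, mem_filter, mem_product] at hz ⊢
      tauto
  have hS1 : S ≤ #B * #X := by
    rw [← card_product]
    refine card_le_card_of_injOn (fun p => (p.1, f p.1 - p.2)) ?_ ?_
    · intro p hp
      simp only [mem_coe, mem_filter, mem_product] at hp ⊢
      exact ⟨hB'B hp.1.1, hp.2⟩
    · rintro ⟨b, c⟩ _ ⟨b', c'⟩ _ h
      simp only [Prod.mk.injEq] at h ⊢
      obtain ⟨rfl, h⟩ := h
      exact ⟨rfl, by linarith⟩
  have hS2 : S ≤ #C * #X := by
    rw [← card_product]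
    refine card_le_card_of_injOn (fun p => (p.2, f p.1 - p.2)) ?_ ?_
    · intro p hp
      simp only [coe_product, Set.mem_prod, mem_coe, mem_filter, mem_product] at hp ⊢
      exact ⟨hp.1.2, hp.2⟩
    · rintro ⟨b, c⟩ hp ⟨b', c'⟩ hp' h
      simp only [coe_filter, Set.mem_ofPred_eq, mem_product] at hp hp'
      simp only [Prod.mk.injEq] at h ⊢
      obtain ⟨rfl, h⟩ := h
      exact ⟨hf (hB'B hp.1.1) (hB'B hp'.1.1) (by linarith), rfl⟩
  have hsS' : (s : ℝ) * S ≤ J := by exact_mod_cast hsS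
  have hS1' : (S : ℝ) ≤ #B * #X := by exact_mod_cast hS1
  have hS2' : (S : ℝ) ≤ #C * #X := by exact_mod_cast hS2
  have hN' : (#B : ℝ) ≤ N := by exact_mod_cast hN
  have hX1 : (#X : ℝ) ≤ (#X : ℝ) ^ 2 := by
    exact_mod_cast Nat.le_self_pow two_ne_zero _
  have hb1 : (0 : ℝ) ≤ #B' := by positivity
  have hS0 : (0 : ℝ) ≤ S := by positivity
  have hc0 : (0 : ℝ) ≤ #C := by positivity
  have hx0 : (0 : ℝ) ≤ #X := by positivity
  have hn0 : (0 : ℝ) ≤ #B := by positivity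
  generalize (S : ℝ) = S at *
  generalize (J : ℝ) = J at *
  generalize (s : ℝ) = s at *
  generalize (t : ℝ) = t at *
  generalize (#C : ℝ) = c at *
  generalize (#X : ℝ) = x at *
  generalize (#P : ℝ) = p at *
  generalize (#B : ℝ) = n at *
  generalize (#B' : ℝ) = b at *
  generalize (N : ℝ) = N at *
  have key : s ^ 3 * S ^ 3 ≤ 686 * (n * x * (p * c)) ^ 2 := by
    rcases le_or_gt (p * c) ((n * x) ^ 2) with h | h
    · calc s ^ 3 * S ^ 3 = (s * S) ^ 3 := by ring
        _ ≤ J ^ 3 := by gcongr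
        _ ≤ _ := hJbound
        _ = 343 * ((n * x * (p * c)) ^ 2 + (p * c) ^ 2 * (p * c)) := by ring
        _ ≤ 343 * ((n * x * (p * c)) ^ 2 + (p * c) ^ 2 * (n * x) ^ 2) := by gcongr
        _ = _ := by ring
    · have h1 : s ^ 3 ≤ n ^ 2 * p := by
        calc s ^ 3 = s * s * s := by ring
          _ ≤ n * n * p := by gcongr
          _ = _ := by ring
      have h2 : S ^ 3 ≤ (n * x) * (n * x) * (c * x) := by
        calc S ^ 3 = S * S * S := by ring
          _ ≤ _ := by gcongr
      calc s ^ 3 * S ^ 3 ≤ (n ^ 2 * p) * ((n * x) * (n * x) * (c * x)) := by gcongr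
        _ = (n * x) ^ 2 * (p * c) * (n ^ 2 * x) := by ring
        _ ≤ (n * x) ^ 2 * (p * c) * (n ^ 2 * x ^ 2) := by gcongr
        _ = (n * x) ^ 2 * (p * c) * (n * x) ^ 2 := by ring
        _ ≤ (n * x) ^ 2 * (p * c) * (p * c) := by gcongr
        _ = (n * x * (p * c)) ^ 2 := by ring
        _ ≤ 686 * (n * x * (p * c)) ^ 2 := by nlinarith [sq_nonneg (n * x * (p * c))]
  have hT' : T * p ^ 2 ≤ l ^ 3 * s ^ 3 * b ^ 3 := by
    calc T * p ^ 2 ≤ t ^ 3 * p * p ^ 2 := by gcongr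
      _ = (t * p) ^ 3 := by ring
      _ ≤ (l * (s * b)) ^ 3 := by gcongr
      _ = _ := by ring
  have : S ^ 3 * T ≤ 686 * l ^ 3 * N ^ 2 * b ^ 3 * c ^ 2 * x ^ 2 := by
    refine le_of_mul_le_mul_right (a := p ^ 2 * s ^ 3) ?_ (by positivity)
    calc S ^ 3 * T * (p ^ 2 * s ^ 3) = (s ^ 3 * S ^ 3) * (T * p ^ 2) := by ring
      _ ≤ (686 * (n * x * (p * c)) ^ 2) * (l ^ 3 * s ^ 3 * b ^ 3) := by gcongr
      _ ≤ (686 * (N * x * (p * c)) ^ 2) * (l ^ 3 * s ^ 3 * b ^ 3) := by gcongr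
      _ = _ := by ring
  calc S ^ 3 = S ^ 3 * T / T := by field_simp
    _ ≤ (686 * l ^ 3 * N ^ 2 * b ^ 3 * c ^ 2 * x ^ 2) / T := by gcongr
    _ = _ := by ring

/-- If every large subset has many popular `g`-differences, then some large subset is controlled
with respect to `f`. -/
lemma exists_controlled_subset {f g : ℝ → ℝ} (hfg : IncidenceBound f g) {B : Finset ℝ}
    (hB : ∀ b ∈ B, 0 < b) (hf : Set.InjOn f B) (hg : Set.InjOn g B) {N : ℕ} (hN : #B ≤ N) {l : ℝ}
    (hl : 1 + Real.log N ≤ l) {h T : ℝ} (hT : 0 < T) (hcard : 2 * h ≤ #B)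
    (hpop : ∀ B' ⊆ B, h ≤ #B' → ∃ t : ℕ, T ≤ (t : ℝ) ^ 3 * #(popularDiff (B'.image g) t)) :
    ∃ B' ⊆ B, h ≤ #B' ∧ Controlled (686 * l ^ 3 * N ^ 2 / T) (B'.image f) := by
  classical
  set K := 686 * l ^ 3 * N ^ 2 / T
  obtain ⟨D, hD, hmax⟩ := exists_max_image {D ∈ B.powerset | Controlled K (D.image f)} card
    ⟨∅, by simp [controlled_empty]⟩
  simp only [mem_filter, mem_powerset] at hD hmax
  refine ⟨D, hD.1, ?_, hD.2⟩
  by_contra! hlt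
  have hs : B \ D ⊆ B := sdiff_subset
  have hcs : (#(B \ D) : ℝ) = #B - #D := by
    rw [card_sdiff_of_subset hD.1, Nat.cast_sub (card_le_card hD.1)]
  obtain ⟨t, ht⟩ := hpop (B \ D) hs (by rw [hcs]; linarith)
  obtain ⟨D', hD', hne, hc⟩ := exists_controlled_piece hfg (fun b hb => hB b (hs hb))
    (hf.mono (by exact_mod_cast hs)) (hg.mono (by exact_mod_cast hs))
    ((card_le_card hs).trans hN) hl hT ht
  have hdisj : Disjoint D D' :=
    disjoint_of_subset_right hD' disjoint_sdiff
  have hsub : D ∪ D' ⊆ B := union_subset hD.1 (hD'.trans hs)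
  have hdisj' : Disjoint (D.image f) (D'.image f) := by
    rw [disjoint_left]
    rintro _ h1 h2
    obtain ⟨a, ha, rfl⟩ := mem_image.1 h1
    obtain ⟨b, hb, e⟩ := mem_image.1 h2
    have := hf (hs (hD' hb)) (hD.1 ha) e
    subst this
    exact disjoint_left.1 hdisj ha hb
  have := hmax (D ∪ D') ⟨hsub, by rw [image_union]; exact hD.2.union hc hdisj'⟩
  rw [card_union_of_disjoint hdisj] at this
  have := hne.card_pos
  omega

section Counting
variable {α β γ : Type*} [DecidableEq γ]

lemma sum_card_fiber_mul_le (S : Finset α) (R : Finset β) (u : α → γ) (v : β → γ) (W : Finset γ) :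
    ∑ w ∈ W, #{s ∈ S | u s = w} * #{r ∈ R | v r = w} ≤ #{z ∈ S ×ˢ R | u z.1 = v z.2} := by
  classical
  have : ∀ w ∈ W, #{s ∈ S | u s = w} * #{r ∈ R | v r = w} =
      #{z ∈ {z ∈ S ×ˢ R | u z.1 = v z.2} | u z.1 = w} := by
    intro w _
    rw [← card_product]
    congr 1
    ext ⟨s, r⟩
    simp only [mem_product, mem_filter]
    constructor
    · rintro ⟨⟨h1, h2⟩, h3, h4⟩
      exact ⟨⟨⟨h1, h3⟩, h2.trans h4.symm⟩, h2⟩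
    · rintro ⟨⟨⟨h1, h3⟩, h4⟩, h2⟩
      exact ⟨⟨h1, h2⟩, h3, h4.symm.trans h2⟩
  rw [sum_congr rfl this, ← card_biUnion]
  · refine card_le_card ?_
    intro z hz
    obtain ⟨w, -, hz⟩ := mem_biUnion.1 hz
    exact (mem_filter.1 hz).1
  · intro w _ w' _ h
    rw [Function.onFun, disjoint_left]
    intro z hz hz'
    exact h ((mem_filter.1 hz).2.symm.trans (mem_filter.1 hz').2)

lemma card_eq_sum_card_fiber_mul (S : Finset α) (R : Finset β) (u : α → γ) (v : β → γ) :
    #{z ∈ S ×ˢ R | u z.1 = v z.2} =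
      ∑ w ∈ S.image u, #{s ∈ S | u s = w} * #{r ∈ R | v r = w} := by
  refine le_antisymm ?_ (sum_card_fiber_mul_le S R u v _)
  rw [card_eq_sum_card_fiberwise (s := {z ∈ S ×ˢ R | u z.1 = v z.2}) (t := S.image u)
    (f := fun z => u z.1)]
  · refine sum_le_sum fun w _ => ?_
    rw [← card_product]
    refine card_le_card ?_
    rintro ⟨s, r⟩ h
    simp only [mem_product, mem_filter] at h ⊢
    exact ⟨⟨h.1.1.1, h.2⟩, h.1.1.2, h.1.2.symm.trans h.2⟩
  · intro z hz
    simp only [mem_coe, mem_filter, mem_product, mem_image] at hz ⊢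
    exact ⟨z.1, hz.1.1, rfl⟩

lemma card_coincidence_sq_le (S : Finset α) (R : Finset β) (u : α → γ) (v : β → γ) :
    #{z ∈ S ×ˢ R | u z.1 = v z.2} ^ 2 ≤
      #{z ∈ S ×ˢ S | u z.1 = u z.2} * #{z ∈ R ×ˢ R | v z.1 = v z.2} := by
  rw [card_eq_sum_card_fiber_mul S R u v]
  refine (sum_mul_sq_le_sq_mul_sq _ _ _).trans (Nat.mul_le_mul ?_ ?_)
  · simp only [sq]; exact sum_card_fiber_mul_le S S u u _
  · simp only [sq]; exact sum_card_fiber_mul_le R R v v _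

end Counting

/-- The number of solutions to `a - x = b - y` with `a, b ∈ B` and `x, y ∈ C`. -/
noncomputable def diffEnergy (B C : Finset ℝ) : ℕ :=
  #{z ∈ (B ×ˢ C) ×ˢ (B ×ˢ C) | z.1.1 - z.1.2 = z.2.1 - z.2.2}

lemma diffEnergy_eq_sum (B C : Finset ℝ) :
    diffEnergy B C = ∑ x ∈ (B ×ˢ C).image fun p => p.1 - p.2, diffRep B C x ^ 2 := by
  rw [diffEnergy, card_eq_sum_card_fiber_mul (B ×ˢ C) (B ×ˢ C) (fun p => p.1 - p.2)
    (fun p => p.1 - p.2)]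
  simp only [sq, diffRep]

lemma diffRep_le_left (B C : Finset ℝ) (x : ℝ) : diffRep B C x ≤ #B := by
  refine card_le_card_of_injOn Prod.fst (fun p hp => (mem_product.1 (mem_filter.1 hp).1).1) ?_
  rintro ⟨b, c⟩ hp ⟨b', c'⟩ hp' h
  simp only [coe_filter, Set.mem_ofPred_eq] at hp hp' h
  subst h
  have : c = c' := by linarith [hp.2, hp'.2]
  rw [this]

lemma mul_card_popular_le (B C : Finset ℝ) (t : ℕ) (X : Finset ℝ)
    (hX : ∀ x ∈ X, t ≤ diffRep B C x) :
    t * #X ≤ #{p ∈ B ×ˢ C | p.1 - p.2 ∈ X} := by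
  rw [card_eq_sum_card_fiberwise (s := {p ∈ B ×ˢ C | p.1 - p.2 ∈ X}) (t := X)
    (f := fun p : ℝ × ℝ => p.1 - p.2) (fun p hp => (mem_filter.1 hp).2), mul_comm,
    ← smul_eq_mul, ← sum_const]
  refine sum_le_sum fun x hx => (hX x hx).trans (card_le_card fun p hp => ?_)
  simp only [mem_filter] at hp ⊢
  exact ⟨⟨hp.1, by rw [hp.2]; exact hx⟩, hp.2⟩

lemma Controlled.pow_three_mul_card_le {K : ℝ} {B : Finset ℝ} (h : Controlled K B) (hK : 0 ≤ K)
    (C : Finset ℝ) (t : ℕ) (X : Finset ℝ) (hX : ∀ x ∈ X, t ≤ diffRep B C x) :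
    (t : ℝ) ^ 3 * #X ≤ K * (#B : ℝ) ^ 3 * (#C : ℝ) ^ 2 := by
  rcases X.eq_empty_or_nonempty with rfl | hne
  · simp; positivity
  have h1 : (t : ℝ) * #X ≤ #{p ∈ B ×ˢ C | p.1 - p.2 ∈ X} := by
    exact_mod_cast mul_card_popular_le B C t X hX
  have h2 := h.pow_three_le hK C X
  have hx : (0 : ℝ) < #X := by exact_mod_cast hne.card_pos
  refine le_of_mul_le_mul_right (a := (#X : ℝ) ^ 2) ?_ (by positivity)
  calc (t : ℝ) ^ 3 * #X * (#X : ℝ) ^ 2 = ((t : ℝ) * #X) ^ 3 := by ring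
    _ ≤ _ := by gcongr
    _ ≤ _ := h2

lemma Controlled.diffEnergy_sq_le {K : ℝ} {B : Finset ℝ} (h : Controlled K B) (hK : 0 ≤ K) {N : ℕ}
    (hN : #B ≤ N) {l : ℝ} (hl : 1 + Real.log N ≤ l) (C : Finset ℝ) :
    (diffEnergy B C : ℝ) ^ 2 ≤ 4 * l ^ 2 * K * (#B : ℝ) ^ 4 * (#C : ℝ) ^ 3 := by
  have hl0 : 0 < l := lt_of_lt_of_le (by have := Real.log_natCast_nonneg N; linarith) hl
  set D := (B ×ˢ C).image fun p => p.1 - p.2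
  have hE : (diffEnergy B C : ℝ) = ∑ x ∈ D, (diffRep B C x : ℝ) ^ 2 := by
    rw [diffEnergy_eq_sum]; push_cast; rfl
  rcases (sum_nonneg fun x (_ : x ∈ D) => sq_nonneg (diffRep B C x : ℝ)).eq_or_lt with h0 | h0
  · rw [hE, ← h0, zero_pow two_ne_zero]; positivity
  obtain ⟨t, -, -, ht⟩ := exists_level D (diffRep B C) N 2
    (fun x _ => (diffRep_le_left B C x).trans hN) (by norm_num) hl h0
  set X := {x ∈ D | t ≤ diffRep B C x}
  have hX : ∀ x ∈ X, t ≤ diffRep B C x := fun x hx => (mem_filter.1 hx).2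
  have h1 := h.pow_three_mul_card_le hK C t X hX
  have h2 : (t : ℝ) * #X ≤ #B * #C := by
    rw [← Nat.cast_mul (#B), ← card_product]
    exact_mod_cast (mul_card_popular_le B C t X hX).trans (card_le_card (filter_subset _ _))
  rw [← hE] at ht
  push_cast at ht
  calc (diffEnergy B C : ℝ) ^ 2 ≤ (2 * l * ((t : ℝ) ^ 2 * #X)) ^ 2 := by gcongr
    _ = 4 * l ^ 2 * (((t : ℝ) ^ 3 * #X) * (t * #X)) := by ring
    _ ≤ 4 * l ^ 2 * ((K * (#B : ℝ) ^ 3 * (#C : ℝ) ^ 2) * (#B * #C)) := by gcongr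
    _ = _ := by ring

lemma diffRep_neg (B : Finset ℝ) (x : ℝ) : diffRep B B (-x) = diffRep B B x := by
  refine card_bij (fun p _ => (p.2, p.1)) ?_ ?_ ?_
  · rintro ⟨a, b⟩ h
    simp only [mem_filter, mem_product] at h ⊢
    exact ⟨⟨h.1.2, h.1.1⟩, by linarith⟩
  · rintro ⟨a, b⟩ _ ⟨a', b'⟩ _ h
    simp only [Prod.mk.injEq] at h ⊢
    exact ⟨h.2, h.1⟩
  · rintro ⟨a, b⟩ h
    simp only [mem_filter, mem_product] at h
    exact ⟨(b, a), by simp only [mem_filter, mem_product]; exact ⟨⟨h.1.2, h.1.1⟩, by linarith⟩, rfl⟩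

lemma mem_popularDiff {B : Finset ℝ} {t : ℕ} (ht : 1 ≤ t) {x : ℝ} :
    x ∈ popularDiff B t ↔ t ≤ diffRep B B x := by
  simp only [popularDiff, mem_filter, mem_image, and_iff_right_iff_imp]
  intro h
  obtain ⟨p, hp⟩ := card_pos.1 (lt_of_lt_of_le (by omega : 0 < t) h)
  exact ⟨p, (mem_filter.1 hp).1, (mem_filter.1 hp).2⟩

/-- Quadruple counts `b - d = c - e` where `b, c` are joined to a common `a` through `P`. -/
noncomputable def starEnergy (B P : Finset ℝ) : ℕ :=
  ∑ a ∈ B, diffEnergy {b ∈ B | a - b ∈ P} B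

lemma starEnergy_lower (B : Finset ℝ) {t : ℕ} (ht : 1 ≤ t) :
    t ^ 6 * #(popularDiff B t) ^ 4 ≤
      #B ^ 3 * diffEnergy B B * starEnergy B (popularDiff B t) := by
  set P := popularDiff B t with hP
  set Q : ℝ → Finset ℝ := fun a => {b ∈ B | a - b ∈ P} with hQ
  set M : ℝ → ℕ := fun a => #{z ∈ (Q a ×ˢ B) ×ˢ (B ×ˢ B) | z.1.1 - z.1.2 = z.2.1 - z.2.2} with hM
  have hMsq : ∀ a, M a ^ 2 ≤ diffEnergy (Q a) B * diffEnergy B B := fun a =>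
    card_coincidence_sq_le (Q a ×ˢ B) (B ×ˢ B) (fun p => p.1 - p.2) (fun p => p.1 - p.2)
  have hsumsq : (∑ a ∈ B, M a) ^ 2 ≤ #B * (starEnergy B P * diffEnergy B B) := by
    refine (sq_sum_le_card_mul_sum_sq).trans (Nat.mul_le_mul le_rfl ?_)
    rw [starEnergy, sum_mul]
    exact sum_le_sum fun a _ => hMsq a
  have hMeq : ∀ a, M a = ∑ b ∈ Q a, ∑ d ∈ B, diffRep B B (b - d) := by
    intro a
    simp only [hM]
    rw [card_filter, sum_product, sum_product]
    refine sum_congr rfl fun b _ => sum_congr rfl fun d _ => ?_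
    rw [diffRep, card_filter]
    refine sum_congr rfl fun p _ => ?_
    simp only [eq_comm]
  have hdeg : ∀ a b, a - b ∈ P ↔ b - a ∈ P := fun a b => by
    rw [hP, mem_popularDiff ht, mem_popularDiff ht, ← diffRep_neg, neg_sub]
  have hMsum : ∑ b ∈ B, t * #(Q b) ^ 2 ≤ ∑ a ∈ B, M a := by
    have e : ∑ a ∈ B, M a = ∑ b ∈ B, #(Q b) * ∑ d ∈ B, diffRep B B (b - d) := by
      simp only [hMeq, hQ, sum_filter, card_filter]
      rw [sum_comm]
      refine sum_congr rfl fun b _ => ?_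
      rw [sum_mul]
      refine sum_congr rfl fun a _ => ?_
      simp only [hdeg a b, ite_mul, one_mul, zero_mul]
    rw [e]
    refine sum_le_sum fun b _ => ?_
    have : #(Q b) * t ≤ ∑ d ∈ B, diffRep B B (b - d) := by
      rw [← smul_eq_mul, ← sum_const]
      calc ∑ d ∈ Q b, t ≤ ∑ d ∈ Q b, diffRep B B (b - d) :=
            sum_le_sum fun d hd => (mem_popularDiff ht).1 (mem_filter.1 hd).2
        _ ≤ _ := sum_le_sum_of_subset (filter_subset _ _)
    calc t * #(Q b) ^ 2 = #(Q b) * (#(Q b) * t) := by ring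
      _ ≤ _ := Nat.mul_le_mul le_rfl this
  have he : t * #P ≤ ∑ b ∈ B, #(Q b) := by
    refine (mul_card_popular_le B B t P fun x hx => (mem_popularDiff ht).1 hx).trans (le_of_eq ?_)
    rw [card_filter, sum_product]
    simp only [hQ, card_filter]
  have he2 : (t * #P) ^ 2 ≤ #B * ∑ b ∈ B, #(Q b) ^ 2 :=
    (Nat.pow_le_pow_left he 2).trans sq_sum_le_card_mul_sum_sq
  have h3 : t ^ 3 * #P ^ 2 ≤ #B * ∑ a ∈ B, M a := by
    calc t ^ 3 * #P ^ 2 = t * (t * #P) ^ 2 := by ring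
      _ ≤ t * (#B * ∑ b ∈ B, #(Q b) ^ 2) := Nat.mul_le_mul le_rfl he2
      _ = #B * ∑ b ∈ B, t * #(Q b) ^ 2 := by rw [← mul_sum]; ring
      _ ≤ _ := Nat.mul_le_mul le_rfl hMsum
  calc t ^ 6 * #P ^ 4 = (t ^ 3 * #P ^ 2) ^ 2 := by ring
    _ ≤ (#B * ∑ a ∈ B, M a) ^ 2 := Nat.pow_le_pow_left h3 2
    _ = #B ^ 2 * (∑ a ∈ B, M a) ^ 2 := by ring
    _ ≤ #B ^ 2 * (#B * (starEnergy B P * diffEnergy B B)) := Nat.mul_le_mul le_rfl hsumsq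
    _ = _ := by ring

lemma starEnergy_sq_le (B P : Finset ℝ) :
    starEnergy B P ^ 2 ≤ (∑ x ∈ (B ×ˢ B).image fun p => p.1 - p.2, diffRep B B x ^ 3) *
      ∑ p ∈ P ×ˢ P, diffRep B B (p.2 - p.1) ^ 2 := by
  set S := B ×ˢ (B ×ˢ B)
  set φ : ℝ × ℝ × ℝ → ℝ × ℝ := fun s => (s.1 - s.2.1, s.1 - s.2.2) with hφ
  have e : starEnergy B P = ∑ p ∈ P ×ˢ P, #{s ∈ S | φ s = p} * diffRep B B (p.2 - p.1) := by
    have e1 : starEnergy B P = ∑ s ∈ {s ∈ S | φ s ∈ P ×ˢ P}, diffRep B B (s.2.1 - s.2.2) := by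
      rw [sum_filter, sum_product]
      refine sum_congr rfl fun a _ => ?_
      rw [← sum_filter, diffEnergy]
      have e2 : ({p ∈ B ×ˢ B | φ (a, p) ∈ P ×ˢ P} : Finset (ℝ × ℝ)) =
          {b ∈ B | a - b ∈ P} ×ˢ {b ∈ B | a - b ∈ P} := by
        ext ⟨b, c⟩
        simp only [hφ, mem_filter, mem_product]
        tauto
      rw [e2, card_filter, sum_product, sum_product, sum_product]
      refine sum_congr rfl fun b _ => ?_
      simp only [diffRep, card_filter, sum_product]
      rw [sum_comm]
      refine sum_congr rfl fun c _ => ?_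
      refine sum_congr rfl fun d _ => sum_congr rfl fun e _ => ?_
      have : b - d = c - e ↔ d - e = b - c := by
        constructor <;> intro h <;> linarith
      simp only [this]
    rw [e1, ← sum_fiberwise_of_maps_to (t := P ×ˢ P) (g := φ)]
    · refine sum_congr rfl fun p hp => ?_
      have e3 : ∀ s ∈ {s ∈ {s ∈ S | φ s ∈ P ×ˢ P} | φ s = p}, diffRep B B (s.2.1 - s.2.2) =
          diffRep B B (p.2 - p.1) := by
        intro s hs
        rw [← (mem_filter.1 hs).2]
        simp only [hφ]
        congr 1
        ring
      rw [sum_congr rfl e3, sum_const, smul_eq_mul]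
      congr 2
      ext s
      simp only [mem_filter]
      constructor
      · rintro ⟨⟨h1, h2⟩, h3⟩; exact ⟨h1, h3⟩
      · rintro ⟨h1, h3⟩; exact ⟨⟨h1, by rw [h3]; exact hp⟩, h3⟩
    · intro s hs
      exact (mem_filter.1 hs).2
  rw [e]
  refine (sum_mul_sq_le_sq_mul_sq _ _ _).trans (Nat.mul_le_mul ?_ le_rfl)
  have h1 : ∑ p ∈ P ×ˢ P, #{s ∈ S | φ s = p} ^ 2 ≤ #{z ∈ S ×ˢ S | φ z.1 = φ z.2} := by
    simp only [sq]; exact sum_card_fiber_mul_le S S φ φ _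
  refine h1.trans ?_
  rw [card_eq_sum_card_fiberwise (s := {z ∈ S ×ˢ S | φ z.1 = φ z.2})
    (t := (B ×ˢ B).image fun p => p.1 - p.2) (f := fun z => z.1.1 - z.2.1)]
  · refine sum_le_sum fun x _ => ?_
    have : diffRep B B x ^ 3 = #({p ∈ B ×ˢ B | p.1 - p.2 = x} ×ˢ
      ({p ∈ B ×ˢ B | p.1 - p.2 = x} ×ˢ {p ∈ B ×ˢ B | p.1 - p.2 = x})) := by
      simp only [card_product, diffRep]; ring
    rw [this]
    refine card_le_card_of_injOn
      (fun z => ((z.1.1, z.2.1), (z.1.2.1, z.2.2.1), (z.1.2.2, z.2.2.2))) ?_ ?_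
    · rintro ⟨⟨a, b, c⟩, a', b', c'⟩ h
      simp only [S, hφ, mem_coe, mem_filter, mem_product, Prod.mk.injEq] at h ⊢
      obtain ⟨⟨⟨⟨h1, h2, h3⟩, h4, h5, h6⟩, h7, h8⟩, h9⟩ := h
      exact ⟨⟨⟨h1, h4⟩, h9⟩, ⟨⟨h2, h5⟩, by linarith⟩, ⟨h3, h6⟩, by linarith⟩
    · rintro ⟨⟨a, b, c⟩, a', b', c'⟩ _ ⟨⟨d, e, f⟩, d', e', f'⟩ _ h
      simp only [Prod.mk.injEq] at h ⊢
      tauto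
  · rintro ⟨⟨a, b, c⟩, a', b', c'⟩ h
    simp only [S, mem_coe, mem_filter, mem_product, mem_image] at h ⊢
    exact ⟨(a, a'), ⟨h.1.1.1, h.1.2.1⟩, rfl⟩

lemma mul_card_popular_pairs_le (B P : Finset ℝ) (s : ℕ) :
    s * #{p ∈ P ×ˢ P | s ≤ diffRep B B (p.2 - p.1)} ≤ diffEnergy B P := by
  rw [diffEnergy, mul_comm, ← smul_eq_mul, ← sum_const]
  calc _ ≤ ∑ p ∈ {p ∈ P ×ˢ P | s ≤ diffRep B B (p.2 - p.1)},
        #{q ∈ B ×ˢ B | q.1 - q.2 = p.2 - p.1} := sum_le_sum fun p hp => (mem_filter.1 hp).2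
    _ ≤ _ := by
        rw [← card_sigma]
        refine card_le_card_of_injOn (fun z => ((z.2.1, z.1.2), (z.2.2, z.1.1))) ?_ ?_
        · rintro ⟨⟨x, y⟩, a, b⟩ h
          simp only [coe_sigma, Set.mem_sigma_iff, mem_coe, mem_filter, mem_product] at h ⊢
          exact ⟨⟨⟨h.2.1.1, h.1.1.2⟩, h.2.1.2, h.1.1.1⟩, by linarith [h.2.2]⟩
        · rintro ⟨⟨x, y⟩, a, b⟩ _ ⟨⟨x', y'⟩, a', b'⟩ _ h
          simp only [Prod.mk.injEq] at h
          obtain ⟨⟨rfl, rfl⟩, rfl, rfl⟩ := h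
          rfl

lemma mul_card_popular_pairs_sq_le (B : Finset ℝ) {s t : ℕ} (hs : 1 ≤ s) (ht : 1 ≤ t) :
    (t * #{p ∈ popularDiff B t ×ˢ popularDiff B t | s ≤ diffRep B B (p.2 - p.1)}) ^ 2 ≤
      diffEnergy B (popularDiff B s) * diffEnergy B (popularDiff B t) := by
  set P := popularDiff B t
  set R := popularDiff B s
  have h1 : t * #{p ∈ P ×ˢ P | s ≤ diffRep B B (p.2 - p.1)} ≤
      #{z ∈ (B ×ˢ R) ×ˢ (B ×ˢ P) | z.1.1 - z.1.2 = z.2.1 + z.2.2} := by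
    rw [mul_comm, ← smul_eq_mul, ← sum_const]
    calc _ ≤ ∑ p ∈ {p ∈ P ×ˢ P | s ≤ diffRep B B (p.2 - p.1)},
          #{q ∈ B ×ˢ B | q.1 - q.2 = p.2} := sum_le_sum fun p hp =>
            (mem_popularDiff ht).1 (mem_product.1 (mem_filter.1 hp).1).2
      _ ≤ _ := by
          rw [← card_sigma]
          refine card_le_card_of_injOn
            (fun z => ((z.2.1, z.1.2 - z.1.1), (z.2.2, z.1.1))) ?_ ?_
          · rintro ⟨⟨x, y⟩, a, b⟩ h
            simp only [coe_sigma, Set.mem_sigma_iff, mem_coe, mem_filter, mem_product] at h ⊢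
            exact ⟨⟨⟨h.2.1.1, (mem_popularDiff hs).2 h.1.2⟩, h.2.1.2, h.1.1.1⟩,
              by linarith [h.2.2]⟩
          · rintro ⟨⟨x, y⟩, a, b⟩ _ ⟨⟨x', y'⟩, a', b'⟩ _ h
            simp only [Prod.mk.injEq] at h
            obtain ⟨⟨rfl, h⟩, rfl, rfl⟩ := h
            have : y = y' := by linarith
            subst this
            rfl
  refine (Nat.pow_le_pow_left h1 2).trans ((card_coincidence_sq_le (B ×ˢ R) (B ×ˢ P)
    (fun p => p.1 - p.2) (fun p => p.1 + p.2)).trans (Nat.mul_le_mul le_rfl ?_))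
  refine card_le_card_of_injOn (fun z => ((z.1.1, z.2.2), (z.2.1, z.1.2))) ?_ ?_
  · rintro ⟨⟨a, x⟩, b, y⟩ h
    simp only [mem_coe, mem_filter, mem_product] at h ⊢
    exact ⟨⟨⟨h.1.1.1, h.1.2.2⟩, h.1.2.1, h.1.1.2⟩, by linarith [h.2]⟩
  · rintro ⟨⟨a, x⟩, b, y⟩ _ ⟨⟨a', x'⟩, b', y'⟩ _ h
    simp only [Prod.mk.injEq] at h ⊢
    tauto

/-- Sixth-moment free energy bound for controlled sets with few popular differences. -/
theorem Controlled.energy_pow_le {K : ℝ} {B : Finset ℝ} (h : Controlled K B) (hK : 0 ≤ K) {N : ℕ}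
    (hN : #B ≤ N) {l : ℝ} (hl : 1 + Real.log N ≤ l) {T : ℝ} (hT0 : 0 ≤ T)
    (hT : ∀ t : ℕ, 1 ≤ t → (t : ℝ) ^ 3 * #(popularDiff B t) ≤ T) :
    (diffEnergy B B : ℝ) ^ 26 ≤ 2 ^ 49 * l ^ 46 * (#B : ℝ) ^ 32 * K ^ 2 * T ^ 12 := by
  have hl0 : 0 < l := lt_of_lt_of_le (by have := Real.log_natCast_nonneg N; linarith) hl
  set D := (B ×ˢ B).image fun p => p.1 - p.2 with hD
  have hE : (diffEnergy B B : ℝ) = ∑ x ∈ D, (diffRep B B x : ℝ) ^ 2 := by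
    rw [diffEnergy_eq_sum]; push_cast; rfl
  rcases (Nat.cast_nonneg (α := ℝ) (diffEnergy B B)).eq_or_lt with h0 | h0
  · rw [← h0, zero_pow (by norm_num)]; positivity
  obtain ⟨t, ht1, -, ht⟩ := exists_level D (diffRep B B) N 2
    (fun x _ => (diffRep_le_left B B x).trans hN) (by norm_num) hl (hE ▸ h0)
  rw [← hE] at ht
  set P := popularDiff B t with hP
  have hPeq : {x ∈ D | t ≤ diffRep B B x} = P := rfl
  rw [hPeq] at ht
  have ht0 : (0 : ℝ) < t := by exact_mod_cast ht1
  have hP0 : (0 : ℝ) < #P := by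
    rcases Nat.eq_zero_or_pos #P with h' | h'
    · rw [h', Nat.cast_zero, mul_zero, mul_zero] at ht; linarith
    · exact_mod_cast h'
  have hZlow : (t : ℝ) ^ 6 * (#P : ℝ) ^ 4 ≤ (#B : ℝ) ^ 3 * diffEnergy B B * starEnergy B P := by
    exact_mod_cast starEnergy_lower B ht1
  have hcube : (∑ x ∈ D, (diffRep B B x : ℝ) ^ 3) ≤ 3 * l * T := by
    refine (sum_pow_le_of_level_le D (diffRep B B) N 3
      (fun x _ => (diffRep_le_left B B x).trans hN) (by norm_num) T hT0
      fun u hu _ => hT u hu).trans ?_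
    push_cast
    gcongr
  set X : ℝ := ∑ p ∈ P ×ˢ P, (diffRep B B (p.2 - p.1) : ℝ) ^ 2 with hX
  have hX0 : 0 ≤ X := sum_nonneg fun _ _ => sq_nonneg _
  have hZup : (starEnergy B P : ℝ) ^ 2 ≤ 3 * l * T * X := by
    calc (starEnergy B P : ℝ) ^ 2 ≤ (∑ x ∈ D, (diffRep B B x : ℝ) ^ 3) * X := by
          rw [hX, hD]; exact_mod_cast starEnergy_sq_le B P
      _ ≤ _ := by gcongr
  have hXbound : X ^ 4 * (t : ℝ) ^ 5 ≤
      256 * l ^ 8 * K ^ 2 * (#B : ℝ) ^ 8 * (#P : ℝ) ^ 3 * T ^ 3 := by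
    rcases hX0.eq_or_lt with h' | h'
    · rw [← h', zero_pow (by norm_num), zero_mul]; positivity
    obtain ⟨s, hs1, -, hs⟩ := exists_level (P ×ˢ P) (fun p => diffRep B B (p.2 - p.1)) N 2
      (fun x _ => (diffRep_le_left B B _).trans hN) (by norm_num) hl h'
    rw [← hX] at hs
    push_cast at hs
    set J : ℝ := (#{p ∈ P ×ˢ P | s ≤ diffRep B B (p.2 - p.1)} : ℝ) with hJ
    have hs0 : (0 : ℝ) < s := by exact_mod_cast hs1
    set R := popularDiff B s with hR
    have hRT : (s : ℝ) ^ 3 * #R ≤ T := hT s hs1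
    have hPT : (t : ℝ) ^ 3 * #P ≤ T := hT t ht1
    have e1 := h.diffEnergy_sq_le hK hN hl P
    have e2 := h.diffEnergy_sq_le hK hN hl R
    have j1 : s * J ≤ diffEnergy B P := by rw [hJ]; exact_mod_cast mul_card_popular_pairs_le B P s
    have j2 : (t * J) ^ 2 ≤ (diffEnergy B R : ℝ) * diffEnergy B P := by
      rw [hJ]; exact_mod_cast mul_card_popular_pairs_sq_le B hs1 ht1
    have hJ0 : 0 ≤ J := by positivity
    have hr0 : (0 : ℝ) ≤ #R := by positivity
    have hn0 : (0 : ℝ) ≤ #B := by positivity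
    have he1 : (0 : ℝ) ≤ diffEnergy B P := by positivity
    have he2 : (0 : ℝ) ≤ diffEnergy B R := by positivity
    clear_value J X
    generalize (diffEnergy B P : ℝ) = E1 at *
    generalize (diffEnergy B R : ℝ) = E2 at *
    generalize (#R : ℝ) = r at *
    generalize (#P : ℝ) = p at *
    generalize (#B : ℝ) = n at *
    have key : s ^ 8 * J ^ 4 * (t : ℝ) ^ 5 ≤ 16 * l ^ 4 * K ^ 2 * n ^ 8 * p ^ 3 * T ^ 3 := by
      rcases le_total (s : ℝ) t with hst | hst
      · calc s ^ 8 * J ^ 4 * (t : ℝ) ^ 5 = ((s * J) ^ 2) ^ 2 * s ^ 4 * t ^ 5 := by ring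
          _ ≤ (E1 ^ 2) ^ 2 * t ^ 4 * t ^ 5 := by gcongr
          _ ≤ (4 * l ^ 2 * K * n ^ 4 * p ^ 3) ^ 2 * t ^ 4 * t ^ 5 := by gcongr
          _ = 16 * l ^ 4 * K ^ 2 * n ^ 8 * p ^ 3 * (t ^ 3 * p) ^ 3 := by ring
          _ ≤ _ := by gcongr
      · calc s ^ 8 * J ^ 4 * (t : ℝ) ^ 5 = ((t * J) ^ 2) ^ 2 * s ^ 8 * t := by ring
          _ ≤ (E2 * E1) ^ 2 * s ^ 8 * s := by gcongr
          _ = E2 ^ 2 * E1 ^ 2 * s ^ 9 := by ring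
          _ ≤ (4 * l ^ 2 * K * n ^ 4 * r ^ 3) * (4 * l ^ 2 * K * n ^ 4 * p ^ 3) * s ^ 9 := by gcongr
          _ = 16 * l ^ 4 * K ^ 2 * n ^ 8 * p ^ 3 * (s ^ 3 * r) ^ 3 := by ring
          _ ≤ _ := by gcongr
    calc X ^ 4 * (t : ℝ) ^ 5 ≤ (2 * l * (s ^ 2 * J)) ^ 4 * t ^ 5 := by gcongr
      _ = 16 * l ^ 4 * (s ^ 8 * J ^ 4 * t ^ 5) := by ring
      _ ≤ 16 * l ^ 4 * (16 * l ^ 4 * K ^ 2 * n ^ 8 * p ^ 3 * T ^ 3) := by gcongr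
      _ = _ := by ring
  have hPT : (t : ℝ) ^ 3 * #P ≤ T := hT t ht1
  have hZ0 : (0 : ℝ) ≤ starEnergy B P := by positivity
  have hn0 : (0 : ℝ) ≤ #B := by positivity
  push_cast at ht
  clear_value X
  generalize (diffEnergy B B : ℝ) = E at *
  generalize (starEnergy B P : ℝ) = Z at *
  generalize (#P : ℝ) = p at *
  generalize (#B : ℝ) = n at *
  generalize (t : ℝ) = t at *
  have h1 : t ^ 53 * p ^ 32 ≤
      n ^ 24 * E ^ 8 * (20736 * l ^ 12 * K ^ 2 * n ^ 8 * p ^ 3 * T ^ 7) := by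
    calc t ^ 53 * p ^ 32 = (t ^ 6 * p ^ 4) ^ 8 * t ^ 5 := by ring
      _ ≤ (n ^ 3 * E * Z) ^ 8 * t ^ 5 := by gcongr
      _ = n ^ 24 * E ^ 8 * ((Z ^ 2) ^ 4 * t ^ 5) := by ring
      _ ≤ n ^ 24 * E ^ 8 * ((3 * l * T * X) ^ 4 * t ^ 5) := by gcongr
      _ = n ^ 24 * E ^ 8 * (81 * l ^ 4 * T ^ 4 * (X ^ 4 * t ^ 5)) := by ring
      _ ≤ n ^ 24 * E ^ 8 * (81 * l ^ 4 * T ^ 4 *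
          (256 * l ^ 8 * K ^ 2 * n ^ 8 * p ^ 3 * T ^ 3)) := by gcongr
      _ = _ := by ring
  have h2 : t ^ 53 * p ^ 29 ≤ 20736 * l ^ 12 * n ^ 32 * E ^ 8 * K ^ 2 * T ^ 7 := by
    refine le_of_mul_le_mul_right (a := p ^ 3) ?_ (by positivity)
    calc t ^ 53 * p ^ 29 * p ^ 3 = t ^ 53 * p ^ 32 := by ring
      _ ≤ _ := h1
      _ = _ := by ring
  refine le_of_mul_le_mul_right (a := E ^ 8) ?_ (by positivity)
  calc E ^ 26 * E ^ 8 = E ^ 34 := by ring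
    _ ≤ (2 * l * (t ^ 2 * p)) ^ 34 := by gcongr
    _ = 2 ^ 34 * l ^ 34 * (t ^ 53 * p ^ 29) * (t ^ 3 * p) ^ 5 := by ring
    _ ≤ 2 ^ 34 * l ^ 34 * (20736 * l ^ 12 * n ^ 32 * E ^ 8 * K ^ 2 * T ^ 7) * T ^ 5 := by gcongr
    _ = (2 ^ 34 * 20736) * (l ^ 46 * n ^ 32 * E ^ 8 * K ^ 2 * T ^ 12) := by ring
    _ ≤ 2 ^ 49 * (l ^ 46 * n ^ 32 * E ^ 8 * K ^ 2 * T ^ 12) := by gcongr; norm_num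
    _ = _ := by ring

lemma diffRep_mono {B B' : Finset ℝ} (h : B' ⊆ B) (x : ℝ) : diffRep B' B' x ≤ diffRep B B x :=
  card_le_card (filter_subset_filter _ (product_subset_product h h))

lemma popularDiff_mono {B B' : Finset ℝ} (h : B' ⊆ B) (t : ℕ) :
    popularDiff B' t ⊆ popularDiff B t := by
  intro x hx
  simp only [popularDiff, mem_filter] at hx ⊢
  exact ⟨image_subset_image (product_subset_product h h) hx.1, hx.2.trans (diffRep_mono h x)⟩

set_option maxRecDepth 4000 in
/-- One round of the energy increment: popular `g`-differences and large `f`-energy of all large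
subsets produce more popular `f`-differences. -/
lemma exists_popular_of_energy {f g : ℝ → ℝ} (hfg : IncidenceBound f g) {A : Finset ℝ}
    (hA : ∀ a ∈ A, 0 < a) (hf : Set.InjOn f A) (hg : Set.InjOn g A) {N : ℕ} (hN : #A = N) {l : ℝ}
    (hl : 1 + Real.log N ≤ l) {h₀ h T V : ℝ} (hh₀ : 0 < h₀) (hNh : N ≤ 2 * l * h₀) (hh : h₀ ≤ h)
    (hT : 0 < T) (hV : 0 ≤ V)
    (hE : ∀ B ⊆ A, h₀ ≤ #B → 2 ^ 140 * V * l ^ 160 * (#B : ℝ) ^ 104 ≤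
      (diffEnergy (B.image f) (B.image f) : ℝ) ^ 26 * N ^ 33)
    (hpop : ∀ B ⊆ A, h ≤ #B → ∃ t : ℕ, T ≤ (t : ℝ) ^ 3 * #(popularDiff (B.image g) t))
    {B : Finset ℝ} (hB : B ⊆ A) (hcard : 2 * h ≤ #B) :
    ∃ t : ℕ, ∃ T' ≤ (t : ℝ) ^ 3 * #(popularDiff (B.image f) t), 0 ≤ T' ∧
      V * l ^ 36 * T ^ 2 * N ^ 35 ≤ T' ^ 12 ∧ T' * T ≤ 686 * l ^ 3 * N ^ 7 := by
  have hl0 : 0 < l := lt_of_lt_of_le (by have := Real.log_natCast_nonneg N; linarith) hl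
  have hBA : (B : Set ℝ) ⊆ A := by exact_mod_cast hB
  obtain ⟨B', hB', hcB', hctrl⟩ := exists_controlled_subset hfg (fun b hb => hA b (hB hb))
    (hf.mono hBA) (hg.mono hBA) (N := N) (by rw [← hN]; exact card_le_card hB) hl hT hcard
    (fun B' h1 h2 => hpop B' (h1.trans hB) h2)
  have hB'A : (B' : Set ℝ) ⊆ A := by exact_mod_cast hB'.trans hB
  set F := B'.image f with hF
  have hcF : #F = #B' := card_image_of_injOn (hf.mono hB'A)
  have hFN : #F ≤ N := by rw [hcF, ← hN]; exact card_le_card (hB'.trans hB)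
  have hn0 : (0 : ℝ) < #B' := hh₀.trans_le (hh.trans hcB')
  have hn1 : 1 ≤ #B' := by exact_mod_cast hn0
  obtain ⟨t, ht, hmax⟩ := exists_max_image (Icc 1 #B')
    (fun t : ℕ => (t : ℝ) ^ 3 * #(popularDiff F t)) ⟨1, by simp [hn1]⟩
  set T' := (t : ℝ) ^ 3 * #(popularDiff F t) with hT'
  have hT'0 : 0 ≤ T' := by positivity
  have hall : ∀ s : ℕ, 1 ≤ s → (s : ℝ) ^ 3 * #(popularDiff F s) ≤ T' := by
    intro s hs
    rcases le_or_gt s #B' with h' | h'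
    · exact hmax s (mem_Icc.2 ⟨hs, h'⟩)
    · have : popularDiff F s = ∅ := by
        rw [eq_empty_iff_forall_notMem]
        intro x hx
        have h1 := (mem_popularDiff hs).1 hx
        have h2 := diffRep_le_left F F x
        omega
      rw [this]; simpa using hT'0
  set K := 686 * l ^ 3 * (N : ℝ) ^ 2 / T with hK
  have hK0 : 0 ≤ K := by positivity
  have hKT : K * T = 686 * l ^ 3 * (N : ℝ) ^ 2 := by rw [hK]; field_simp
  have hen := hctrl.energy_pow_le hK0 hFN hl hT'0 hall
  have hE' := hE B' (hB'.trans hB) (hh.trans hcB')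
  have hup := hctrl.pow_three_mul_card_le hK0 F t (popularDiff F t)
    (fun x hx => (mem_popularDiff (mem_Icc.1 ht).1).1 hx)
  have hNn : (#B' : ℝ) ≤ N := by rw [← hcF]; exact_mod_cast hFN
  rw [hcF] at hen hup
  refine ⟨t, T', ?_, hT'0, ?_, ?_⟩
  · rw [hT']
    gcongr
    exact popularDiff_mono (image_subset_image hB') t
  · have hNn2 : (N : ℝ) ≤ 2 * l * #B' := hNh.trans (by gcongr; exact hh.trans hcB')
    have hN0 : (0 : ℝ) < N := hn0.trans_le hNn
    rw [← hF] at hE'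
    clear_value T' K F
    generalize (diffEnergy F F : ℝ) = E at *
    generalize (#B' : ℝ) = n at *
    generalize (N : ℝ) = N at *
    have h1 : 2 ^ 140 * V * l ^ 160 * n ^ 72 ≤ 2 ^ 49 * l ^ 46 * K ^ 2 * T' ^ 12 * N ^ 33 := by
      refine le_of_mul_le_mul_right (a := n ^ 32) ?_ (by positivity)
      calc 2 ^ 140 * V * l ^ 160 * n ^ 72 * n ^ 32 = 2 ^ 140 * V * l ^ 160 * n ^ 104 := by ring
        _ ≤ E ^ 26 * N ^ 33 := hE'
        _ ≤ (2 ^ 49 * l ^ 46 * n ^ 32 * K ^ 2 * T' ^ 12) * N ^ 33 := by gcongr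
        _ = _ := by ring
    refine le_of_mul_le_mul_right (a := 2 ^ 140 * l ^ 124 * N ^ 37) ?_ (by positivity)
    calc V * l ^ 36 * T ^ 2 * N ^ 35 * (2 ^ 140 * l ^ 124 * N ^ 37)
        = 2 ^ 140 * V * l ^ 160 * T ^ 2 * N ^ 72 := by ring
      _ ≤ 2 ^ 140 * V * l ^ 160 * T ^ 2 * (2 * l * n) ^ 72 := by gcongr
      _ = (2 ^ 140 * V * l ^ 160 * n ^ 72) * (2 ^ 72 * l ^ 72 * T ^ 2) := by ring
      _ ≤ (2 ^ 49 * l ^ 46 * K ^ 2 * T' ^ 12 * N ^ 33) * (2 ^ 72 * l ^ 72 * T ^ 2) := by gcongr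
      _ = 2 ^ 121 * l ^ 118 * (K * T) ^ 2 * T' ^ 12 * N ^ 33 := by ring
      _ = 2 ^ 121 * 686 ^ 2 * (T' ^ 12 * (l ^ 124 * N ^ 37)) := by rw [hKT]; ring
      _ ≤ 2 ^ 140 * (T' ^ 12 * (l ^ 124 * N ^ 37)) :=
          mul_le_mul_of_nonneg_right (by norm_num) (by positivity)
      _ = _ := by ring
  · calc T' * T ≤ K * (#B' : ℝ) ^ 3 * (#B' : ℝ) ^ 2 * T := by gcongr
      _ = K * T * (#B' : ℝ) ^ 5 := by ring
      _ ≤ K * T * (N : ℝ) ^ 5 := by gcongr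
      _ = _ := by rw [hKT]; ring

/-- Every finite set of positive reals has a large subset whose additive or multiplicative energy
is small. -/
theorem exists_subset_energy_le {A : Finset ℝ} (hA : ∀ a ∈ A, 0 < a) (hne : A.Nonempty) {N : ℕ}
    (hN : #A = N) {l : ℝ} (hl : l = 1 + Real.log N) :
    ∃ B ⊆ A, (N : ℝ) ≤ 2 * l * #B ∧ ∃ f : ℝ → ℝ, (f = id ∨ f = Real.log) ∧
      (diffEnergy (B.image f) (B.image f) : ℝ) ^ 26 * N ^ 33 ≤
        2 ^ 140 * (2 * 686 ^ 12 * Real.exp 98) * l ^ 160 * (#B : ℝ) ^ 104 := by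
  set V : ℝ := 2 * 686 ^ 12 * Real.exp 98 with hV
  have hN1 : 1 ≤ N := by rw [← hN]; exact hne.card_pos
  have hN0 : (0 : ℝ) < N := by exact_mod_cast hN1
  have hlog : 0 ≤ Real.log N := Real.log_natCast_nonneg N
  have hl1 : 1 ≤ l := by linarith
  have hV1 : 1 ≤ V := by
    have := Real.one_le_exp (show (0 : ℝ) ≤ 98 by norm_num)
    rw [hV]; linarith
  by_contra! hcon
  obtain ⟨n, hn1, hn2⟩ := exists_nat_pow_near hl1 (one_lt_two (α := ℝ))
  set h₀ : ℝ := N / 2 ^ (n + 1) with hh₀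
  have hh₀pos : 0 < h₀ := by positivity
  have hNh : (N : ℝ) ≤ 2 * l * h₀ := by
    have : (2 : ℝ) ^ (n + 1) ≤ 2 * l := by rw [pow_succ]; linarith
    calc (N : ℝ) = 2 ^ (n + 1) * h₀ := by rw [hh₀]; field_simp
      _ ≤ _ := by gcongr
  have hE : ∀ f : ℝ → ℝ, (f = id ∨ f = Real.log) → ∀ B ⊆ A, h₀ ≤ #B →
      2 ^ 140 * V * l ^ 160 * (#B : ℝ) ^ 104 ≤
        (diffEnergy (B.image f) (B.image f) : ℝ) ^ 26 * N ^ 33 := fun f hf B hB hc =>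
    (hcon B hB (hNh.trans (by gcongr)) f hf).le
  have hinj : ∀ f : ℝ → ℝ, (f = id ∨ f = Real.log) → Set.InjOn f A := by
    rintro f (rfl | rfl)
    · exact Function.injective_id.injOn
    · exact fun a ha b hb h => Real.log_injOn_pos (hA a ha) (hA b hb) h
  have hother : ∀ f : ℝ → ℝ, (f = id ∨ f = Real.log) →
      ∃ g : ℝ → ℝ, (g = id ∨ g = Real.log) ∧ IncidenceBound f g := by
    rintro f (rfl | rfl)
    · exact ⟨_, Or.inr rfl, incidenceBound_id_log⟩
    · exact ⟨_, Or.inl rfl, incidenceBound_log_id⟩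
  set τ : ℕ → ℝ := fun i => Real.exp (7 / 2 * (1 - (1 / 6) ^ i) * Real.log N) with hτ
  have hτpos : ∀ i, 0 < τ i := fun i => Real.exp_pos _
  have hNexp : (N : ℝ) = Real.exp (Real.log N) := (Real.exp_log hN0).symm
  have hNpow : ∀ k : ℕ, (N : ℝ) ^ k = Real.exp (k * Real.log N) := fun k => by
    rw [Real.exp_nat_mul, Real.exp_log hN0]
  have claim : ∀ i : ℕ, ∀ f : ℝ → ℝ, (f = id ∨ f = Real.log) → ∀ B ⊆ A, h₀ * 2 ^ i ≤ #B →
      ∃ t : ℕ, τ i ≤ (t : ℝ) ^ 3 * #(popularDiff (B.image f) t) := by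
    intro i
    induction i with
    | zero =>
      intro f _ B _ hc
      refine ⟨1, ?_⟩
      have hB0 : (0 : ℝ) < #B := lt_of_lt_of_le (by positivity) hc
      obtain ⟨b, hb⟩ := card_pos.1 (by exact_mod_cast hB0 : 0 < #B)
      have : 0 < #(popularDiff (B.image f) 1) := by
        refine card_pos.2 ⟨0, (mem_popularDiff le_rfl).2 (card_pos.2 ⟨(f b, f b), ?_⟩)⟩
        simp only [mem_filter, mem_product, sub_self, and_true, and_self]
        exact mem_image_of_mem f hb
      simp only [hτ, pow_zero, sub_self, mul_zero, zero_mul, Real.exp_zero, Nat.cast_one, one_pow,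
        one_mul]
      exact_mod_cast this
    | succ i ih =>
      intro f hf B hB hc
      obtain ⟨g, hg, hfg⟩ := hother f hf
      have h2i : (1 : ℝ) ≤ 2 ^ i := one_le_pow₀ one_le_two
      obtain ⟨t, T', hT't, hT'0, hT', -⟩ := exists_popular_of_energy hfg hA (hinj f hf) (hinj g hg)
        hN hl.ge hh₀pos hNh (h := h₀ * 2 ^ i) (by nlinarith) (hτpos i) (by linarith) (hE f hf)
        (ih g hg) hB (by rw [pow_succ] at hc; linarith)
      refine ⟨t, le_trans ?_ hT't⟩
      refine le_of_pow_le_pow_left₀ (n := 12) (by norm_num) hT'0 (le_trans ?_ hT')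
      have e : τ (i + 1) ^ 12 = τ i ^ 2 * N ^ 35 := by
        simp only [hτ, hNpow]
        rw [← Real.exp_nat_mul, ← Real.exp_nat_mul, ← Real.exp_add]
        congr 1
        push_cast
        ring
      have h36 : 1 ≤ V * l ^ 36 := one_le_mul_of_one_le_of_one_le hV1 (one_le_pow₀ hl1)
      have hpos : 0 ≤ τ i ^ 2 * (N : ℝ) ^ 35 := by positivity
      rw [e]
      nlinarith
  obtain ⟨g, hg, hfg⟩ := hother id (Or.inl rfl)
  have h2n : (1 : ℝ) ≤ 2 ^ n := one_le_pow₀ one_le_two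
  obtain ⟨t, T', hT't, hT'0, hT', hup⟩ := exists_popular_of_energy hfg hA (hinj id (Or.inl rfl))
    (hinj g hg) hN hl.ge hh₀pos hNh (h := h₀ * 2 ^ n) (by nlinarith) (hτpos n) (by linarith)
    (hE id (Or.inl rfl)) (claim n g hg) subset_rfl
    (by rw [hN, hh₀, pow_succ]; field_simp; rfl)
  have h1 : V * l ^ 36 * (τ n ^ 14 * N ^ 35) ≤ 686 ^ 12 * l ^ 36 * N ^ 84 := by
    calc V * l ^ 36 * (τ n ^ 14 * N ^ 35) = V * l ^ 36 * τ n ^ 2 * N ^ 35 * τ n ^ 12 := by ring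
      _ ≤ T' ^ 12 * τ n ^ 12 := by have := hτpos n; gcongr
      _ = (T' * τ n) ^ 12 := by ring
      _ ≤ (686 * l ^ 3 * N ^ 7) ^ 12 := by have := hτpos n; gcongr
      _ = _ := by ring
  have h2 : (N : ℝ) ^ 84 ≤ τ n ^ 14 * N ^ 35 * Real.exp 98 := by
    simp only [hτ, hNpow]
    rw [← Real.exp_nat_mul, ← Real.exp_add, ← Real.exp_add, Real.exp_le_exp]
    push_cast
    have h6 : (1 / 6 : ℝ) ^ n * Real.log N ≤ 2 := by
      have : (1 / 6 : ℝ) ^ n ≤ (1 / 2) ^ n := by gcongr; norm_num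
      calc (1 / 6 : ℝ) ^ n * Real.log N ≤ (1 / 2) ^ n * l := by gcongr; linarith
        _ ≤ (1 / 2) ^ n * 2 ^ (n + 1) := by gcongr
        _ = 2 := by rw [pow_succ, ← mul_assoc, ← mul_pow]; norm_num
    nlinarith
  have h3 : 0 < τ n ^ 14 * N ^ 35 * l ^ 36 := by have := hτpos n; positivity
  have h4 : V * l ^ 36 * (τ n ^ 14 * N ^ 35) ≤
      686 ^ 12 * l ^ 36 * (τ n ^ 14 * N ^ 35 * Real.exp 98) := h1.trans (by gcongr)
  have h5 : V * l ^ 36 * (τ n ^ 14 * N ^ 35) =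
    2 * (686 ^ 12 * l ^ 36 * (τ n ^ 14 * N ^ 35 * Real.exp 98)) := by rw [hV]; ring
  have h6 : 0 < 686 ^ 12 * l ^ 36 * (τ n ^ 14 * N ^ 35 * Real.exp 98) := by
    have := hτpos n
    positivity
  linarith

/-- Finitely many reals admit an injective integer model preserving additive relations. -/
lemma exists_int_model (B : Finset ℝ) {g : ℝ → ℝ} (hg : Set.InjOn g B) :
    ∃ h : ℝ → ℤ, Set.InjOn h B ∧ ∀ a ∈ B, ∀ b ∈ B, ∀ c ∈ B, ∀ d ∈ B,
      g a + g b = g c + g d → h a + h b = h c + h d := by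
  obtain ⟨φ, hφ⟩ := Module.exists_dual_forall_apply_ne_zero (K := ℚ) (M := ℝ)
    (fun q : {q : B × B // q.1 ≠ q.2} => g q.1.1 - g q.1.2)
    fun q => sub_ne_zero.2 fun h => q.2 (Subtype.ext (hg q.1.1.2 q.1.2.2 h))
  obtain ⟨m, hm⟩ := IsLocalization.exist_integer_multiples_of_finset (nonZeroDivisors ℤ)
    (B.image fun b => φ (g b))
  have hm0 : ((m : ℤ) : ℚ) ≠ 0 := by exact_mod_cast nonZeroDivisors.coe_ne_zero m
  have hex : ∀ b, ∃ z : ℤ, b ∈ B → (z : ℚ) = (m : ℤ) * φ (g b) := by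
    intro b
    by_cases hb : b ∈ B
    · obtain ⟨z, hz⟩ := hm (φ (g b)) (mem_image_of_mem _ hb)
      exact ⟨z, fun _ => by simpa using hz⟩
    · exact ⟨0, fun h => absurd h hb⟩
  choose h hh using hex
  refine ⟨h, fun a ha b hb hab => ?_, fun a ha b hb c hc d hd hs => ?_⟩
  · by_contra hne
    have := hφ ⟨(⟨a, ha⟩, ⟨b, hb⟩), fun h => hne (by simpa using h)⟩
    apply this
    have h1 := hh a ha
    rw [hab, hh b hb] at h1
    rw [map_sub, sub_eq_zero]
    exact (mul_left_cancel₀ hm0 h1).symm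
  · have h1 : ((h a + h b : ℤ) : ℚ) = (h c + h d : ℤ) := by
      push_cast
      rw [hh a ha, hh b hb, hh c hc, hh d hd, ← mul_add, ← mul_add, ← map_add, ← map_add, hs]
    exact_mod_cast h1

lemma card_collapse_le {p Q : ℕ} (hQ : Q.Prime) (hp : 0 < p) (hpQ : p < Q) {a b : ℤ}
    (hd : ¬ (Q : ℤ) ∣ a - b) :
    p * #((range Q).filter fun t : ℕ =>
      (p : ℤ) ∣ (t : ℤ) * a * p / Q - (t : ℤ) * b * p / Q) ≤ 3 * Q := by
  have hQ0 : (0 : ℤ) < Q := by exact_mod_cast hQ.pos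
  have hp0 : (0 : ℤ) < p := by exact_mod_cast hp
  have key : ∀ t : ℕ, (p : ℤ) ∣ (t : ℤ) * a * p / Q - (t : ℤ) * b * p / Q →
      ∃ s k : ℤ, (t : ℤ) * (a - b) = Q * k + s ∧
        (t : ℤ) * a * p % Q - (t : ℤ) * b * p % Q = p * s := by
    rintro t ⟨k, hk⟩
    have h1 := Int.mul_ediv_add_emod ((t : ℤ) * a * p) Q
    have h2 := Int.mul_ediv_add_emod ((t : ℤ) * b * p) Q
    refine ⟨t * (a - b) - Q * k, k, by ring, ?_⟩
    linear_combination h1 - h2 - (Q : ℤ) * hk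
  have hcard : #((range Q).filter fun t : ℕ =>
      (p : ℤ) ∣ (t : ℤ) * a * p / Q - (t : ℤ) * b * p / Q) ≤
      #(Icc (-((Q / p : ℕ) : ℤ)) ((Q / p : ℕ) : ℤ)) := by
    apply card_le_card_of_injOn
      (fun t : ℕ => ((t : ℤ) * a * p % Q - (t : ℤ) * b * p % Q) / p)
    · intro t ht
      simp only [mem_coe, mem_filter, mem_range] at ht
      obtain ⟨s, k, -, hs⟩ := key t ht.2
      have e : ((t : ℤ) * a * p % Q - (t : ℤ) * b * p % Q) / p = s := by
        rw [hs, Int.mul_ediv_cancel_left _ hp0.ne']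
      simp only [e, coe_Icc, Set.mem_Icc]
      have h1 := Int.emod_nonneg ((t : ℤ) * a * p) hQ0.ne'
      have h2 := Int.emod_lt_of_pos ((t : ℤ) * a * p) hQ0
      have h3 := Int.emod_nonneg ((t : ℤ) * b * p) hQ0.ne'
      have h4 := Int.emod_lt_of_pos ((t : ℤ) * b * p) hQ0
      push_cast
      have h5 : -s ≤ (Q : ℤ) / p := (Int.le_ediv_iff_mul_le hp0).2 (by linarith)
      exact ⟨by linarith, (Int.le_ediv_iff_mul_le hp0).2 (by linarith)⟩
    · intro t ht t' ht' htt
      simp only [mem_coe, mem_filter, mem_range] at ht ht'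
      obtain ⟨s, k, hk, hs⟩ := key t ht.2
      obtain ⟨s', k', hk', hs'⟩ := key t' ht'.2
      simp only [hs, hs', Int.mul_ediv_cancel_left _ hp0.ne'] at htt
      subst htt
      have hdvd : (Q : ℤ) ∣ ((t : ℤ) - t') * (a - b) := ⟨k - k', by linear_combination hk - hk'⟩
      have := ((Nat.prime_iff_prime_int.1 hQ).dvd_or_dvd hdvd).resolve_right hd
      have h0 := Int.eq_zero_of_abs_lt_dvd this (by rw [abs_lt]; constructor <;> omega)
      omega
  have h1 : #(Icc (-((Q / p : ℕ) : ℤ)) ((Q / p : ℕ) : ℤ)) = 2 * (Q / p) + 1 := by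
    rw [Int.card_Icc]; omega
  rw [h1] at hcard
  calc _ ≤ p * (2 * (Q / p) + 1) := Nat.mul_le_mul_left _ hcard
    _ = 2 * (p * (Q / p)) + p := by ring
    _ ≤ 3 * Q := by have := Nat.mul_div_le Q p; omega

lemma ediv_add_ediv_eq {Q y₁ y₂ y₃ y₄ c : ℤ} (hQ : 0 < Q) (h : y₁ + y₂ = y₃ + y₄)
    (h₁ : 2 * (y₁ % Q) / Q = c) (h₂ : 2 * (y₂ % Q) / Q = c) (h₃ : 2 * (y₃ % Q) / Q = c)
    (h₄ : 2 * (y₄ % Q) / Q = c) : y₁ / Q + y₂ / Q = y₃ / Q + y₄ / Q := by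
  have e := fun y => Int.mul_ediv_add_emod y Q
  have l := fun y => Int.mul_ediv_self_le (x := 2 * (y % Q)) hQ.ne'
  have u := fun y => Int.lt_mul_ediv_self_add (x := 2 * (y % Q)) hQ
  have h0 : Q ∣ y₁ % Q + y₂ % Q - (y₃ % Q + y₄ % Q) :=
    ⟨-(y₁ / Q + y₂ / Q - (y₃ / Q + y₄ / Q)), by
      linear_combination e y₁ + e y₂ - e y₃ - e y₄ + h⟩
  have l₁ := l y₁; have l₂ := l y₂; have l₃ := l y₃; have l₄ := l y₄
  have u₁ := u y₁; have u₂ := u y₂; have u₃ := u y₃; have u₄ := u y₄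
  rw [h₁] at l₁ u₁; rw [h₂] at l₂ u₂; rw [h₃] at l₃ u₃; rw [h₄] at l₄ u₄
  have h5 := Int.eq_zero_of_abs_lt_dvd h0 (by rw [abs_lt]; constructor <;> linarith)
  have : Q * (y₁ / Q + y₂ / Q - (y₃ / Q + y₄ / Q)) = 0 := by
    linear_combination e y₁ + e y₂ - e y₃ - e y₄ + h - h5
  have := (mul_eq_zero.1 this).resolve_left hQ.ne'
  linarith

lemma exists_plane_model (B : Finset ℝ) {g : ℝ → ℝ} (hg : Set.InjOn g B) {p : ℕ} (hp : 0 < p) :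
    ∃ (ψ : ℝ → ZMod p × ZMod p) (B' : Finset ℝ), B' ⊆ B ∧ #B ≤ 4 * #B' ∧
      (∀ a ∈ B', ∀ b ∈ B', ∀ c ∈ B', ∀ d ∈ B', g a + g b = g c + g d →
        ψ a + ψ b = ψ c + ψ d) ∧
      #{q ∈ B.offDiag | ψ q.1 = ψ q.2} * p ^ 2 ≤ 9 * #B ^ 2 := by
  obtain ⟨h, hinj, hrel⟩ := exists_int_model B hg
  obtain ⟨Q, hQN, hQ⟩ := Nat.exists_infinite_primes
    (p + 1 + ∑ q ∈ B ×ˢ B, (h q.1 - h q.2).natAbs)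
  have hQ0 : (0 : ℤ) < Q := by exact_mod_cast hQ.pos
  have hnd : ∀ q ∈ B.offDiag, ¬ (Q : ℤ) ∣ h q.1 - h q.2 := by
    intro q hq hdvd
    rw [mem_offDiag] at hq
    have h1 := single_le_sum (f := fun q : ℝ × ℝ => (h q.1 - h q.2).natAbs)
      (fun _ _ => Nat.zero_le _) (mem_product.2 ⟨hq.1, hq.2.1⟩)
    have h2 := Int.eq_zero_of_abs_lt_dvd hdvd (by rw [Int.abs_eq_natAbs]; omega)
    exact hq.2.2 (hinj hq.1 hq.2.1 (sub_eq_zero.1 h2))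
  let C : ℕ → ℝ × ℝ → Prop := fun t q =>
    (p : ℤ) ∣ (t : ℤ) * h q.1 * p / Q - (t : ℤ) * h q.2 * p / Q
  have hC : ∀ q ∈ B.offDiag, p * #{t ∈ range Q | C t q} ≤ 3 * Q := fun q hq =>
    card_collapse_le hQ hp (by omega) (hnd q hq)
  obtain ⟨t, -, ht⟩ : ∃ t ∈ range Q ×ˢ range Q,
      #{q ∈ B.offDiag | C t.1 q ∧ C t.2 q} * p ^ 2 ≤ 9 * #B ^ 2 := by
    apply exists_le_of_sum_le
      (by simpa using hQ.ne_zero)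
    rw [← sum_mul, sum_const, smul_eq_mul, card_product, card_range]
    have hsw : ∑ t ∈ range Q ×ˢ range Q, #{q ∈ B.offDiag | C t.1 q ∧ C t.2 q} =
        ∑ q ∈ B.offDiag, #{t ∈ range Q | C t q} ^ 2 := by
      refine (sum_card_bipartiteAbove_eq_sum_card_bipartiteBelow
        (fun (t : ℕ × ℕ) (q : ℝ × ℝ) => C t.1 q ∧ C t.2 q)).trans (sum_congr rfl fun q _ => ?_)
      rw [bipartiteBelow, filter_product (fun t => C t q) (fun t => C t q), card_product, sq]
    rw [hsw, sum_mul]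
    calc _ ≤ ∑ q ∈ B.offDiag, 9 * Q ^ 2 := sum_le_sum fun q hq => by
          calc _ = (p * #{t ∈ range Q | C t q}) ^ 2 := by ring
            _ ≤ (3 * Q) ^ 2 := Nat.pow_le_pow_left (hC q hq) 2
            _ = _ := by ring
      _ ≤ _ := by
          rw [sum_const, smul_eq_mul, offDiag_card]
          have : #B * #B - #B ≤ #B ^ 2 := by rw [sq]; omega
          nlinarith [Nat.mul_le_mul_right (9 * Q ^ 2) this]
  let Y : ℕ → ℝ → ℤ := fun t x => (t : ℤ) * h x * p
  let cl : ℝ → ℤ × ℤ := fun x => (2 * (Y t.1 x % Q) / Q, 2 * (Y t.2 x % Q) / Q)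
  have hcl : ∀ y : ℤ, 2 * (y % Q) / Q ∈ Ico (0 : ℤ) 2 := by
    intro y
    have h1 := Int.emod_nonneg y hQ0.ne'
    have h2 := Int.emod_lt_of_pos y hQ0
    rw [mem_Ico]
    exact ⟨Int.ediv_nonneg (by linarith) hQ0.le, Int.ediv_lt_of_lt_mul hQ0 (by linarith)⟩
  obtain ⟨c, -, hc⟩ : ∃ c ∈ Ico (0 : ℤ) 2 ×ˢ Ico (0 : ℤ) 2, #B ≤ 4 * #{x ∈ B | cl x = c} := by
    by_contra! hlt
    have h1 := card_eq_sum_card_fiberwise (s := B) (f := cl)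
      (t := Ico (0 : ℤ) 2 ×ˢ Ico (0 : ℤ) 2) fun x _ => mem_product.2 ⟨hcl _, hcl _⟩
    have h2 := sum_lt_sum_of_nonempty (s := Ico (0 : ℤ) 2 ×ˢ Ico (0 : ℤ) 2) (by simp) hlt
    rw [← mul_sum, ← h1, sum_const, card_product, Int.card_Ico] at h2
    simp at h2
  refine ⟨fun x => (((Y t.1 x / Q : ℤ) : ZMod p), ((Y t.2 x / Q : ℤ) : ZMod p)),
    {x ∈ B | cl x = c}, filter_subset _ _, hc, ?_, ?_⟩
  · intro a ha b hb d hd e he hs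
    simp only [mem_filter] at ha hb hd he
    have hh := hrel a ha.1 b hb.1 d hd.1 e he.1 hs
    have hY : ∀ t, Y t a + Y t b = Y t d + Y t e := fun t => by
      simp only [Y]; linear_combination (t : ℤ) * p * hh
    have k1 := ediv_add_ediv_eq hQ0 (hY t.1) (congrArg Prod.fst ha.2) (congrArg Prod.fst hb.2)
      (congrArg Prod.fst hd.2) (congrArg Prod.fst he.2)
    have k2 := ediv_add_ediv_eq hQ0 (hY t.2) (congrArg Prod.snd ha.2) (congrArg Prod.snd hb.2)
      (congrArg Prod.snd hd.2) (congrArg Prod.snd he.2)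
    simp only [Prod.mk_add_mk, ← Int.cast_add, k1, k2]
  · convert ht using 4 with q
    simp only [Prod.mk.injEq, C, Y]
    rw [eq_comm, ZMod.intCast_eq_intCast_iff_dvd_sub, eq_comm (a := ((_ / _ : ℤ) : ZMod p)),
      ZMod.intCast_eq_intCast_iff_dvd_sub]

section Cubic

variable {F : Type*} [Field F]

/-- The point `P` lies on the cubic graph with coefficients `w`. -/
def OnCubic (w : F × F × F × F) (P : F × F) : Prop :=
  P.2 = w.1 * P.1 ^ 3 + w.2.1 * P.1 ^ 2 + w.2.2.1 * P.1 + w.2.2.2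

lemma OnCubic.fst_ne {w : F × F × F × F} {P P' : F × F} (h : OnCubic w P) (h' : OnCubic w P')
    (hne : P ≠ P') : P.1 ≠ P'.1 := by
  intro hx
  apply hne
  unfold OnCubic at h h'
  exact Prod.ext hx (by rw [h, h', hx])

lemma quadratic_coeff_eq {x₁ x₂ x₃ a b c d : F} (h₁₂ : x₁ ≠ x₂) (h₁₃ : x₁ ≠ x₃) (h₂₃ : x₂ ≠ x₃)
    (e₁ : a * x₁ ^ 3 + b * x₁ ^ 2 + c * x₁ + d = 0) (e₂ : a * x₂ ^ 3 + b * x₂ ^ 2 + c * x₂ + d = 0)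
    (e₃ : a * x₃ ^ 3 + b * x₃ ^ 2 + c * x₃ + d = 0) : a * (x₁ + x₂ + x₃) + b = 0 := by
  have e₁₂ : a * (x₁ ^ 2 + x₁ * x₂ + x₂ ^ 2) + b * (x₁ + x₂) + c = 0 :=
    mul_left_cancel₀ (sub_ne_zero.2 h₁₂) (by linear_combination e₁ - e₂)
  have e₁₃ : a * (x₁ ^ 2 + x₁ * x₃ + x₃ ^ 2) + b * (x₁ + x₃) + c = 0 :=
    mul_left_cancel₀ (sub_ne_zero.2 h₁₃) (by linear_combination e₁ - e₃)
  exact mul_left_cancel₀ (sub_ne_zero.2 h₂₃) (by linear_combination e₁₂ - e₁₃)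

lemma OnCubic.eq_of_three {w w' : F × F × F × F} {P₁ P₂ P₃ : F × F} (hw : w.1 = w'.1)
    (h₁₂ : P₁ ≠ P₂) (h₁₃ : P₁ ≠ P₃) (h₂₃ : P₂ ≠ P₃) (h₁ : OnCubic w P₁) (h₂ : OnCubic w P₂)
    (h₃ : OnCubic w P₃) (h₁' : OnCubic w' P₁) (h₂' : OnCubic w' P₂) (h₃' : OnCubic w' P₃) :
    w = w' := by
  have n₁₂ := h₁.fst_ne h₂ h₁₂
  have n₁₃ := h₁.fst_ne h₃ h₁₃
  have n₂₃ := h₂.fst_ne h₃ h₂₃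
  obtain ⟨a, b, c, d⟩ := w
  obtain ⟨a', b', c', d'⟩ := w'
  obtain ⟨x₁, y₁⟩ := P₁
  obtain ⟨x₂, y₂⟩ := P₂
  obtain ⟨x₃, y₃⟩ := P₃
  simp only [OnCubic] at *
  subst hw
  have hb : b = b' := by
    have := quadratic_coeff_eq (a := 0) (b := b - b') (c := c - c') (d := d - d') n₁₂ n₁₃ n₂₃
      (by linear_combination h₁' - h₁) (by linear_combination h₂' - h₂)
      (by linear_combination h₃' - h₃)
    linear_combination this
  subst hb
  have hc : c = c' := mul_left_cancel₀ (sub_ne_zero.2 n₁₂)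
    (by linear_combination h₁' - h₁ - h₂' + h₂)
  subst hc
  have hd : d = d' := by linear_combination h₁' - h₁
  rw [hd]

lemma OnCubic.eq_of_four {w w' : F × F × F × F} {P₁ P₂ P₃ P₄ : F × F}
    (h₁₂ : P₁ ≠ P₂) (h₁₃ : P₁ ≠ P₃) (h₁₄ : P₁ ≠ P₄) (h₂₃ : P₂ ≠ P₃) (h₂₄ : P₂ ≠ P₄)
    (h₃₄ : P₃ ≠ P₄) (h₁ : OnCubic w P₁) (h₂ : OnCubic w P₂) (h₃ : OnCubic w P₃)
    (h₄ : OnCubic w P₄) (h₁' : OnCubic w' P₁) (h₂' : OnCubic w' P₂) (h₃' : OnCubic w' P₃)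
    (h₄' : OnCubic w' P₄) : w = w' := by
  refine OnCubic.eq_of_three ?_ h₁₂ h₁₃ h₂₃ h₁ h₂ h₃ h₁' h₂' h₃'
  have n₁₂ := h₁.fst_ne h₂ h₁₂
  have n₁₃ := h₁.fst_ne h₃ h₁₃
  have n₂₃ := h₂.fst_ne h₃ h₂₃
  have n₁₄ := h₁.fst_ne h₄ h₁₄
  have n₂₄ := h₂.fst_ne h₄ h₂₄
  have n₃₄ := h₃.fst_ne h₄ h₃₄
  simp only [OnCubic] at *
  have k₃ := quadratic_coeff_eq (a := w.1 - w'.1) (b := w.2.1 - w'.2.1) (c := w.2.2.1 - w'.2.2.1)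
      (d := w.2.2.2 - w'.2.2.2) n₁₂ n₁₃ n₂₃
      (by linear_combination h₁' - h₁) (by linear_combination h₂' - h₂)
      (by linear_combination h₃' - h₃)
  have k₄ := quadratic_coeff_eq (a := w.1 - w'.1) (b := w.2.1 - w'.2.1) (c := w.2.2.1 - w'.2.2.1)
      (d := w.2.2.2 - w'.2.2.2) n₁₂ n₁₄ n₂₄
      (by linear_combination h₁' - h₁) (by linear_combination h₂' - h₂)
      (by linear_combination h₄' - h₄)
  exact mul_left_cancel₀ (sub_ne_zero.2 n₃₄) (by linear_combination k₃ - k₄)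

/-- Points of a cubic graph with the same sum form the same pair, unless their abscissae sum to
a constant determined by the cubic. -/
lemma OnCubic.eq_or_sum_eq {w : F × F × F × F} {P₁ P₂ P₃ P₄ : F × F} (h₁ : OnCubic w P₁)
    (h₂ : OnCubic w P₂) (h₃ : OnCubic w P₃) (h₄ : OnCubic w P₄) (hs : P₁ + P₂ = P₃ + P₄) :
    P₁ = P₃ ∨ P₁ = P₄ ∨ 3 * w.1 * (P₁.1 + P₂.1) + 2 * w.2.1 = 0 := by
  have hx : P₁.1 + P₂.1 = P₃.1 + P₄.1 := congrArg Prod.fst hs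
  have hy : P₁.2 + P₂.2 = P₃.2 + P₄.2 := congrArg Prod.snd hs
  by_cases h13 : P₁ = P₃
  · exact .inl h13
  by_cases h14 : P₁ = P₄
  · exact .inr (.inl h14)
  have n13 := h₁.fst_ne h₃ h13
  have n14 := h₁.fst_ne h₄ h14
  unfold OnCubic at *
  rw [h₁, h₂, h₃, h₄] at hy
  have e2 : P₂.1 = P₃.1 + P₄.1 - P₁.1 := by linear_combination hx
  refine .inr (.inr ?_)
  apply mul_left_cancel₀ (mul_ne_zero (sub_ne_zero.2 n13) (sub_ne_zero.2 n14))
  rw [e2] at hy ⊢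
  linear_combination hy

variable [Fintype F] [DecidableEq F]

/-- The coefficient vectors of the genuine cubics. -/
def cubics (F : Type*) [Field F] [Fintype F] [DecidableEq F] : Finset (F × F × F × F) :=
  {w | w.1 ≠ 0}

instance (w : F × F × F × F) : DecidablePred (OnCubic w) := fun _ =>
  inferInstanceAs (Decidable (_ = _))

lemma card_cubics : #(cubics F) = (Fintype.card F - 1) * Fintype.card F ^ 3 := by
  have : cubics F = (univ.erase 0) ×ˢ univ := by ext w; simp [cubics]
  rw [this, card_product, card_erase_of_mem (mem_univ _)]
  simp only [card_univ, Fintype.card_prod]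
  ring

lemma card_cubics_one (P : F × F) :
    #{w ∈ cubics F | OnCubic w P} = (Fintype.card F - 1) * Fintype.card F ^ 2 := by
  have : #{w ∈ cubics F | OnCubic w P} =
      #(((univ : Finset F).erase 0) ×ˢ (univ : Finset (F × F))) := by
    refine card_nbij' (fun w => (w.1, w.2.1, w.2.2.1))
      (fun v => (v.1, v.2.1, v.2.2, P.2 - (v.1 * P.1 ^ 3 + v.2.1 * P.1 ^ 2 + v.2.2 * P.1)))
      ?_ ?_ ?_ ?_
    · intro w hw
      simp_all [cubics]
    · intro v hv
      simp_all [cubics, OnCubic]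
    · intro w hw
      rw [mem_coe, mem_filter, OnCubic] at hw
      ext <;> simp [hw.2]
    · intro v hv
      rfl
  rw [this, card_product, card_erase_of_mem (mem_univ _)]
  simp only [card_univ, Fintype.card_prod]
  ring

lemma card_cubics_three_le {P₁ P₂ P₃ : F × F} (h₁₂ : P₁ ≠ P₂) (h₁₃ : P₁ ≠ P₃) (h₂₃ : P₂ ≠ P₃) :
    #{w ∈ cubics F | OnCubic w P₁ ∧ OnCubic w P₂ ∧ OnCubic w P₃} ≤ Fintype.card F := by
  rw [← card_univ]
  refine card_le_card_of_injOn Prod.fst (fun _ _ => mem_coe.2 (mem_univ _)) ?_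
  intro w hw w' hw' h
  simp only [mem_coe, mem_filter] at hw hw'
  exact OnCubic.eq_of_three h h₁₂ h₁₃ h₂₃ hw.2.1 hw.2.2.1 hw.2.2.2 hw'.2.1 hw'.2.2.1 hw'.2.2.2

lemma card_cubics_four_le {P₁ P₂ P₃ P₄ : F × F} (h₁₂ : P₁ ≠ P₂) (h₁₃ : P₁ ≠ P₃) (h₁₄ : P₁ ≠ P₄)
    (h₂₃ : P₂ ≠ P₃) (h₂₄ : P₂ ≠ P₄) (h₃₄ : P₃ ≠ P₄) :
    #{w ∈ cubics F | OnCubic w P₁ ∧ OnCubic w P₂ ∧ OnCubic w P₃ ∧ OnCubic w P₄} ≤ 1 := by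
  refine card_le_one.2 fun w hw w' hw' => ?_
  simp only [mem_filter] at hw hw'
  exact OnCubic.eq_of_four h₁₂ h₁₃ h₁₄ h₂₃ h₂₄ h₃₄ hw.2.1 hw.2.2.1 hw.2.2.2.1 hw.2.2.2.2
    hw'.2.1 hw'.2.2.1 hw'.2.2.2.1 hw'.2.2.2.2

end Cubic

/-- `f` sends distinct pairs of elements of `S` to distinct sums. -/
def SidonOn (f : ℝ → ℝ) (S : Finset ℝ) : Prop :=
  ∀ a ∈ S, ∀ b ∈ S, ∀ c ∈ S, ∀ d ∈ S, f a + f b = f c + f d → a = c ∧ b = d ∨ a = d ∧ b = c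

lemma SidonOn.mono {f : ℝ → ℝ} {S T : Finset ℝ} (h : SidonOn f T) (hST : S ⊆ T) : SidonOn f S :=
  fun a ha b hb c hc d hd => h a (hST ha) b (hST hb) c (hST hc) d (hST hd)

/-- On a cubic graph over `ZMod p`, one third of any set is Sidon for the vector sum. -/
lemma exists_sidonOn_of_onCubic {p : ℕ} [Fact p.Prime] (hp : 5 ≤ p)
    {w : ZMod p × ZMod p × ZMod p × ZMod p}
    (hw : w.1 ≠ 0) {R : Finset ℝ} {g : ℝ → ℝ} (hg : Set.InjOn g R) {ψ : ℝ → ZMod p × ZMod p}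
    (hψ : Set.InjOn ψ R) (hR : ∀ b ∈ R, OnCubic w (ψ b))
    (hrel : ∀ a ∈ R, ∀ b ∈ R, ∀ c ∈ R, ∀ d ∈ R, g a + g b = g c + g d →
      ψ a + ψ b = ψ c + ψ d) :
    ∃ S ⊆ R, #R ≤ 3 * #S ∧ SidonOn g S := by
  have h2 : (2 : ZMod p) ≠ 0 := by
    intro h
    have := (ZMod.natCast_eq_zero_iff 2 p).1 (by exact_mod_cast h)
    have := Nat.le_of_dvd (by norm_num) this
    omega
  have h3 : (3 : ZMod p) ≠ 0 := by
    intro h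
    have := (ZMod.natCast_eq_zero_iff 3 p).1 (by exact_mod_cast h)
    have := Nat.le_of_dvd (by norm_num) this
    omega
  set s : ZMod p := -(2 * w.2.1) / (3 * w.1) with hs
  have hsum : ∀ x : ZMod p, 3 * w.1 * x + 2 * w.2.1 = 0 → x = s := by
    intro x hx
    rw [hs, eq_div_iff (mul_ne_zero h3 hw)]
    linear_combination hx
  have key : ∀ a ∈ R, ∀ b ∈ R, ∀ c ∈ R, ∀ d ∈ R, g a + g b = g c + g d →
      (a = c ∧ b = d ∨ a = d ∧ b = c) ∨
        ((ψ b).1 = s - (ψ a).1 ∧ (ψ d).1 = s - (ψ c).1) := by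
    intro a ha b hb c hc d hd h
    have hh := hrel a ha b hb c hc d hd h
    rcases (hR a ha).eq_or_sum_eq (hR b hb) (hR c hc) (hR d hd) hh with h1 | h1 | h1
    · have := hψ ha hc h1
      subst this
      exact .inl (.inl ⟨rfl, hg hb hd (add_left_cancel h)⟩)
    · have := hψ ha hd h1
      subst this
      exact .inl (.inr ⟨rfl, hg hb hc (by linarith)⟩)
    · have e1 := hsum _ h1
      have e2 : (ψ a).1 + (ψ b).1 = (ψ c).1 + (ψ d).1 := congrArg Prod.fst hh
      exact .inr ⟨by linear_combination e1, by linear_combination e1 - e2⟩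
  have hA : SidonOn g {b ∈ R | (ψ b).1.val < (s - (ψ b).1).val} := by
    intro a ha b hb c hc d hd h
    simp only [mem_filter] at ha hb hc hd
    refine (key a ha.1 b hb.1 c hc.1 d hd.1 h).resolve_right fun ⟨h1, _⟩ => ?_
    have k1 := ha.2
    have k2 := hb.2
    rw [h1, sub_sub_cancel] at k2
    omega
  have hB : SidonOn g {b ∈ R | (s - (ψ b).1).val < (ψ b).1.val} := by
    intro a ha b hb c hc d hd h
    simp only [mem_filter] at ha hb hc hd
    refine (key a ha.1 b hb.1 c hc.1 d hd.1 h).resolve_right fun ⟨h1, _⟩ => ?_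
    have k1 := ha.2
    have k2 := hb.2
    rw [h1, sub_sub_cancel] at k2
    omega
  have hC : SidonOn g {b ∈ R | (ψ b).1.val = (s - (ψ b).1).val} := by
    have huniq : ∀ a ∈ R, ∀ b ∈ R, (ψ a).1.val = (s - (ψ a).1).val →
        (ψ b).1.val = (s - (ψ b).1).val → a = b := by
      intro a ha b hb h h'
      have h1 := ZMod.val_injective p h
      have h1' := ZMod.val_injective p h'
      have h4 : (ψ a).1 = (ψ b).1 := mul_left_cancel₀ h2 (by linear_combination h1 - h1')
      apply hψ ha hb
      by_contra hne
      exact (hR a ha).fst_ne (hR b hb) hne h4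
    intro a ha b hb c hc d hd h
    simp only [mem_filter] at ha hb hc hd
    exact .inl ⟨huniq a ha.1 c hc.1 ha.2 hc.2, huniq b hb.1 d hd.1 hb.2 hd.2⟩
  have hcard : #R ≤ #{b ∈ R | (ψ b).1.val < (s - (ψ b).1).val} +
      #{b ∈ R | (s - (ψ b).1).val < (ψ b).1.val} +
      #{b ∈ R | (ψ b).1.val = (s - (ψ b).1).val} := by
    refine le_trans (card_le_card fun b hb => ?_)
      ((card_union_le _ _).trans (Nat.add_le_add_right (card_union_le _ _) _))
    simp only [mem_union, mem_filter, hb, true_and]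
    omega
  rcases le_total (#R) (3 * #{b ∈ R | (ψ b).1.val < (s - (ψ b).1).val}) with h1 | h1
  · exact ⟨_, filter_subset _ _, h1, hA⟩
  rcases le_total (#R) (3 * #{b ∈ R | (s - (ψ b).1).val < (ψ b).1.val}) with h4 | h4
  · exact ⟨_, filter_subset _ _, h4, hB⟩
  · exact ⟨_, filter_subset _ _, by omega, hC⟩

/-- The plane points attached to `a, b, c` are pairwise distinct. -/
def Distinct₃ {P : Type*} (ψ : ℝ → P) (a b c : ℝ) : Prop := ψ a ≠ ψ b ∧ ψ a ≠ ψ c ∧ ψ b ≠ ψ c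

instance {P : Type*} [DecidableEq P] (ψ : ℝ → P) (a b c : ℝ) : Decidable (Distinct₃ ψ a b c) :=
  inferInstanceAs (Decidable (_ ∧ _ ∧ _))

lemma card_sum_quadruples_le {B : Finset ℝ} {f : ℝ → ℝ} (hf : Set.InjOn f B) :
    #{z ∈ (B ×ˢ B) ×ˢ (B ×ˢ B) | f z.1.1 + f z.1.2 = f z.2.1 + f z.2.2} ≤
      diffEnergy (B.image f) (B.image f) := by
  refine card_le_card_of_injOn (fun z => ((f z.1.1, f z.2.1), (f z.2.2, f z.1.2))) ?_ ?_
  · rintro ⟨⟨a, b⟩, ⟨c, d⟩⟩ hz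
    simp only [mem_coe, mem_filter, mem_product] at hz ⊢
    obtain ⟨⟨⟨ha, hb⟩, hc, hd⟩, h⟩ := hz
    exact ⟨⟨⟨mem_image_of_mem _ ha, mem_image_of_mem _ hc⟩, mem_image_of_mem _ hd,
      mem_image_of_mem _ hb⟩, by linarith⟩
  · rintro ⟨⟨a, b⟩, ⟨c, d⟩⟩ hz ⟨⟨a', b'⟩, ⟨c', d'⟩⟩ hz' h
    simp only [mem_coe, mem_filter, mem_product] at hz hz'
    simp only [Prod.mk.injEq] at h ⊢
    exact ⟨⟨hf hz.1.1.1 hz'.1.1.1 h.1.1, hf hz.1.1.2 hz'.1.1.2 h.2.2⟩,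
      hf hz.1.2.1 hz'.1.2.1 h.1.2, hf hz.1.2.2 hz'.1.2.2 h.2.1⟩

lemma card_sum_triples_le {B : Finset ℝ} {f : ℝ → ℝ} (hf : Set.InjOn f B) :
    #{z ∈ B ×ˢ (B ×ˢ B) | f z.1 + f z.1 = f z.2.1 + f z.2.2} ≤ #B ^ 2 := by
  rw [sq, ← card_product]
  refine card_le_card_of_injOn Prod.snd ?_ ?_
  · intro z hz
    simp only [mem_coe, mem_filter, mem_product] at hz ⊢
    exact hz.1.2
  · rintro ⟨a, z⟩ hz ⟨a', z'⟩ hz' h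
    simp only [mem_coe, mem_filter, mem_product] at hz hz' h
    subst h
    rw [hf hz.1.1 hz'.1.1 (by linarith)]

/-- Avoiding the nondegenerate coincidences of sums leaves a Sidon set. -/
lemma sidonOn_of_avoid {P : Type*} {R : Finset ℝ} {f : ℝ → ℝ} (hf : Set.InjOn f R) {ψ : ℝ → P}
    (hψ : Set.InjOn ψ R)
    (h₃ : ∀ a ∈ R, ∀ c ∈ R, ∀ d ∈ R, f a + f a = f c + f d → ¬ Distinct₃ ψ a c d)
    (h₄ : ∀ a ∈ R, ∀ b ∈ R, ∀ c ∈ R, ∀ d ∈ R, f a + f b = f c + f d →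
      ¬ (Distinct₃ ψ a b c ∧ ψ a ≠ ψ d ∧ ψ b ≠ ψ d ∧ ψ c ≠ ψ d)) : SidonOn f R := by
  intro a ha b hb c hc d hd h
  have n : ∀ x ∈ R, ∀ y ∈ R, x ≠ y → ψ x ≠ ψ y := fun x hx y hy hne h => hne (hψ hx hy h)
  by_cases hac : a = c
  · subst hac; exact .inl ⟨rfl, hf hb hd (by linarith)⟩
  by_cases had : a = d
  · subst had; exact .inr ⟨rfl, hf hb hc (by linarith)⟩
  by_cases hbc : b = c
  · subst hbc; exact .inr ⟨hf ha hd (by linarith), rfl⟩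
  by_cases hbd : b = d
  · subst hbd; exact .inl ⟨hf ha hc (by linarith), rfl⟩
  exfalso
  by_cases hab : a = b
  · subst hab
    by_cases hcd : c = d
    · subst hcd; exact hac (hf ha hc (by linarith))
    · exact h₃ a ha c hc d hd h ⟨n a ha c hc hac, n a ha d hd had, n c hc d hd hcd⟩
  by_cases hcd : c = d
  · subst hcd
    exact h₃ c hc a ha b hb h.symm ⟨n c hc a ha (Ne.symm hac), n c hc b hb (Ne.symm hbc),
      n a ha b hb hab⟩
  · exact h₄ a ha b hb c hc d hd h ⟨⟨n a ha b hb hab, n a ha c hc hac, n b hb c hc hbc⟩,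
      n a ha d hd had, n b hb d hd hbd, n c hc d hd hcd⟩

lemma sum_card_filter_comm {α β : Type*} (s : Finset α) (t : Finset β) (r : α → β → Prop)
    [∀ a, DecidablePred (r a)] [∀ b, DecidablePred fun a => r a b] :
    ∑ a ∈ s, #{b ∈ t | r a b} = ∑ b ∈ t, #{a ∈ s | r a b} :=
  sum_card_bipartiteAbove_eq_sum_card_bipartiteBelow r

/-- A random cubic meets the model in a large set, most of which survives the removal of all
coincidences. -/
lemma exists_cubic_avoid {p : ℕ} [Fact p.Prime] (hp : 5 ≤ p) {n E : ℕ} {B : Finset ℝ}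
    (hn : n ≤ 4 * #B) (hBn : #B ≤ n) (hnp : 100 * n ≤ p ^ 2)
    (hE : 100 * E ≤ n * p ^ 3) {f : ℝ → ℝ}
    (hf : Set.InjOn f B) (hBE : diffEnergy (B.image f) (B.image f) ≤ E) {ψ : ℝ → ZMod p × ZMod p}
    (hψ : #{q ∈ B.offDiag | ψ q.1 = ψ q.2} * p ^ 2 ≤ 9 * n ^ 2) :
    ∃ w : ZMod p × ZMod p × ZMod p × ZMod p, w.1 ≠ 0 ∧ ∃ R ⊆ B, n ≤ 8 * p * #R ∧
      (∀ b ∈ R, OnCubic w (ψ b)) ∧ Set.InjOn ψ R ∧ SidonOn f R := by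
  set X₂ := {q ∈ B.offDiag | ψ q.1 = ψ q.2} with hX₂
  set X₃ := {z ∈ B ×ˢ (B ×ˢ B) | f z.1 + f z.1 = f z.2.1 + f z.2.2 ∧
    Distinct₃ ψ z.1 z.2.1 z.2.2} with hX₃
  set X₄ := {z ∈ (B ×ˢ B) ×ˢ (B ×ˢ B) | f z.1.1 + f z.1.2 = f z.2.1 + f z.2.2 ∧
    (Distinct₃ ψ z.1.1 z.1.2 z.2.1 ∧ ψ z.1.1 ≠ ψ z.2.2 ∧ ψ z.1.2 ≠ ψ z.2.2 ∧
      ψ z.2.1 ≠ ψ z.2.2)} with hX₄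
  have c₃ : #X₃ ≤ n ^ 2 :=
    (card_le_card fun z hz => by simp only [hX₃, mem_filter] at hz ⊢; exact ⟨hz.1, hz.2.1⟩).trans
      ((card_sum_triples_le hf).trans (Nat.pow_le_pow_left hBn 2))
  have c₄ : #X₄ ≤ E :=
    (card_le_card fun z hz => by simp only [hX₄, mem_filter] at hz ⊢; exact ⟨hz.1, hz.2.1⟩).trans
      ((card_sum_quadruples_le hf).trans hBE)
  let S := fun w => {b ∈ B | OnCubic w (ψ b)}
  let S₂ := fun w => {q ∈ X₂ | OnCubic w (ψ q.1)}
  let S₃ := fun w => {z ∈ X₃ | OnCubic w (ψ z.1) ∧ OnCubic w (ψ z.2.1) ∧ OnCubic w (ψ z.2.2)}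
  let S₄ := fun w => {z ∈ X₄ | OnCubic w (ψ z.1.1) ∧ OnCubic w (ψ z.1.2) ∧
    OnCubic w (ψ z.2.1) ∧ OnCubic w (ψ z.2.2)}
  let R := fun w => S w \ ((S₂ w).image Prod.fst ∪ (S₃ w).image Prod.fst ∪
    (S₄ w).image fun z => z.1.1)
  have hR : ∀ w, #(S w) ≤ #(R w) + #(S₂ w) + #(S₃ w) + #(S₄ w) := by
    intro w
    have h1 := le_card_sdiff ((S₂ w).image Prod.fst ∪ (S₃ w).image Prod.fst ∪
      (S₄ w).image fun z => z.1.1) (S w)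
    have h2 := card_union_le ((S₂ w).image Prod.fst ∪ (S₃ w).image Prod.fst)
      ((S₄ w).image fun z => z.1.1)
    have h3 := card_union_le ((S₂ w).image Prod.fst) ((S₃ w).image Prod.fst)
    have i2 := card_image_le (s := S₂ w) (f := Prod.fst)
    have i3 := card_image_le (s := S₃ w) (f := Prod.fst)
    have i4 := card_image_le (s := S₄ w) (f := fun z => z.1.1)
    simp only [R]
    omega
  obtain ⟨w, hw, hwn⟩ : ∃ w ∈ cubics (ZMod p), n ≤ 8 * p * #(R w) := by
    by_contra! hlt
    have hcard := card_cubics (F := ZMod p)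
    rw [ZMod.card] at hcard
    have hne : (cubics (ZMod p)).Nonempty := by
      rw [← card_pos, hcard]
      exact Nat.mul_pos (by omega) (by positivity)
    have h0 := sum_lt_sum_of_nonempty hne hlt
    rw [← mul_sum, sum_const, smul_eq_mul, hcard] at h0
    have t1 : ∑ w ∈ cubics (ZMod p), #(S w) = #B * ((p - 1) * p ^ 2) := by
      simp only [S]
      rw [sum_card_filter_comm _ _ (fun w b => OnCubic w (ψ b)),
        sum_congr rfl fun b _ => card_cubics_one (ψ b), sum_const, smul_eq_mul, ZMod.card]
    have t2 : ∑ w ∈ cubics (ZMod p), #(S₂ w) = #X₂ * ((p - 1) * p ^ 2) := by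
      simp only [S₂]
      rw [sum_card_filter_comm _ _ (fun w (b : ℝ × ℝ) => OnCubic w (ψ b.1)),
        sum_congr rfl fun b _ => card_cubics_one (ψ b.1), sum_const, smul_eq_mul, ZMod.card]
    have t3 : ∑ w ∈ cubics (ZMod p), #(S₃ w) ≤ #X₃ * p := by
      simp only [S₃]
      rw [sum_card_filter_comm _ _ (fun w (z : ℝ × ℝ × ℝ) => OnCubic w (ψ z.1) ∧
        OnCubic w (ψ z.2.1) ∧ OnCubic w (ψ z.2.2)), ← smul_eq_mul, ← sum_const]
      refine sum_le_sum fun z hz => ?_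
      simp only [hX₃, mem_filter] at hz
      obtain ⟨d1, d2, d3⟩ := hz.2.2
      exact (card_cubics_three_le d1 d2 d3).trans_eq (ZMod.card p)
    have t4 : ∑ w ∈ cubics (ZMod p), #(S₄ w) ≤ #X₄ := by
      simp only [S₄]
      rw [sum_card_filter_comm _ _ (fun w (z : (ℝ × ℝ) × ℝ × ℝ) => OnCubic w (ψ z.1.1) ∧
        OnCubic w (ψ z.1.2) ∧ OnCubic w (ψ z.2.1) ∧ OnCubic w (ψ z.2.2)), card_eq_sum_ones]
      refine sum_le_sum fun z hz => ?_
      simp only [hX₄, mem_filter] at hz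
      obtain ⟨⟨d1, d2, d3⟩, d4, d5, d6⟩ := hz.2.2
      exact card_cubics_four_le d1 d2 d4 d3 d5 d6
    have t0 := sum_le_sum fun w (_ : w ∈ cubics (ZMod p)) => hR w
    simp only [sum_add_distrib] at t0
    rw [t1, t2] at t0
    set M := (p - 1) * p ^ 2 with hM
    have hp0 : 0 < p := by omega
    have hM5 : 4 * p ^ 3 ≤ 5 * M := by
      calc 4 * p ^ 3 = (4 * p) * p ^ 2 := by ring
        _ ≤ (5 * (p - 1)) * p ^ 2 := Nat.mul_le_mul_right _ (by omega)
        _ = 5 * M := by rw [hM]; ring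
    have h8 : 8 * ∑ w ∈ cubics (ZMod p), #(R w) < M * n := by
      refine lt_of_mul_lt_mul_left (a := p) ?_ (Nat.zero_le p)
      calc _ = 8 * p * ∑ w ∈ cubics (ZMod p), #(R w) := by ring
        _ < _ := h0
        _ = _ := by rw [hM]; ring
    have hx₂ : 100 * #X₂ ≤ 9 * n := by
      refine le_of_mul_le_mul_right (a := p ^ 2) ?_ (by positivity)
      nlinarith [Nat.mul_le_mul_left (9 * n) hnp]
    have hx₂M := Nat.mul_le_mul_right M hx₂
    have hnM := Nat.mul_le_mul_left n hM5
    have hx₃ : 80 * (#X₃ * p) ≤ n * M := by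
      have := Nat.mul_le_mul_right p c₃
      have := Nat.mul_le_mul_left (n * p) hnp
      nlinarith
    have hbM := Nat.mul_le_mul_right M hn
    nlinarith
  refine ⟨w, by simpa [cubics] using hw, R w, sdiff_subset.trans (filter_subset _ _), hwn, ?_⟩
  have hRB : ∀ b ∈ R w, b ∈ B ∧ OnCubic w (ψ b) := fun b hb =>
    mem_filter.1 (mem_sdiff.1 hb).1
  have hinj : Set.InjOn ψ (R w) := by
    intro a ha b hb hab
    by_contra hne
    refine (mem_sdiff.1 ha).2 (mem_union_left _ (mem_union_left _ (mem_image.2 ⟨(a, b), ?_, rfl⟩)))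
    simp only [S₂, hX₂, mem_filter, mem_offDiag]
    exact ⟨⟨⟨(hRB a ha).1, (hRB b hb).1, hne⟩, hab⟩, (hRB a ha).2⟩
  refine ⟨fun b hb => (hRB b hb).2, hinj,
    sidonOn_of_avoid (hf.mono fun b hb => (hRB b hb).1) hinj ?_ ?_⟩
  · intro a ha c hc d hd h hdis
    refine (mem_sdiff.1 ha).2 (mem_union_left _ (mem_union_right _
      (mem_image.2 ⟨(a, c, d), ?_, rfl⟩)))
    simp only [S₃, hX₃, mem_filter, mem_product]
    exact ⟨⟨⟨(hRB a ha).1, (hRB c hc).1, (hRB d hd).1⟩, h, hdis⟩,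
      (hRB a ha).2, (hRB c hc).2, (hRB d hd).2⟩
  · intro a ha b hb c hc d hd h hdis
    refine (mem_sdiff.1 ha).2 (mem_union_right _ (mem_image.2 ⟨((a, b), c, d), ?_, rfl⟩))
    simp only [S₄, hX₄, mem_filter, mem_product]
    exact ⟨⟨⟨⟨(hRB a ha).1, (hRB b hb).1⟩, (hRB c hc).1, (hRB d hd).1⟩, h, hdis⟩,
      (hRB a ha).2, (hRB b hb).2, (hRB c hc).2, (hRB d hd).2⟩

lemma exists_sidonOn_of_prime {p : ℕ} (hpp : p.Prime) (hp : 5 ≤ p) {B : Finset ℝ}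
    (hBp : 100 * #B ≤ p ^ 2) {f g : ℝ → ℝ} (hf : Set.InjOn f B) (hg : Set.InjOn g B)
    (hE : 100 * diffEnergy (B.image f) (B.image f) ≤ #B * p ^ 3) :
    ∃ S ⊆ B, #B ≤ 24 * p * #S ∧ SidonOn f S ∧ SidonOn g S := by
  have : Fact p.Prime := ⟨hpp⟩
  obtain ⟨ψ, B', hB', hcard, hrel, hcol⟩ := exists_plane_model B hg hpp.pos
  have hE' : diffEnergy (B'.image f) (B'.image f) ≤ diffEnergy (B.image f) (B.image f) := by
    have h := image_subset_image (f := f) hB'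
    exact card_le_card (filter_subset_filter _
      (product_subset_product (product_subset_product h h) (product_subset_product h h)))
  have hcol' : #{q ∈ B'.offDiag | ψ q.1 = ψ q.2} * p ^ 2 ≤ 9 * #B ^ 2 :=
    (Nat.mul_le_mul_right _ (card_le_card (filter_subset_filter _ (offDiag_mono hB')))).trans hcol
  obtain ⟨w, hw, R, hRB, hRn, hRw, hψ, hRf⟩ := exists_cubic_avoid hp hcard (card_le_card hB') hBp hE
    (hf.mono hB') hE' hcol'
  obtain ⟨S, hSR, hS, hSg⟩ := exists_sidonOn_of_onCubic hp hw (hg.mono (hRB.trans hB')) hψ hRw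
    fun a ha b hb c hc d hd => hrel a (hRB ha) b (hRB hb) c (hRB hc) d (hRB hd)
  refine ⟨S, hSR.trans (hRB.trans hB'), ?_, hRf.mono hSR, hSg⟩
  calc #B ≤ 8 * p * #R := hRn
    _ ≤ 8 * p * (3 * #S) := Nat.mul_le_mul_left _ hS
    _ = _ := by ring

/-- A set with small `f`-energy contains a large set that is Sidon for both `f` and `g`. -/
lemma exists_sidonOn_of_energy {B : Finset ℝ} (hB : B.Nonempty) {f g : ℝ → ℝ} (hf : Set.InjOn f B)
    (hg : Set.InjOn g B) {y : ℝ} (hy : 0 ≤ y)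
    (hE : (diffEnergy (B.image f) (B.image f) : ℝ) ≤ #B * y ^ 3) :
    ∃ S ⊆ B, (#B : ℝ) ≤ 768 * (√(#B) + y) * #S ∧ SidonOn f S ∧ SidonOn g S := by
  have hn1 : (1 : ℝ) ≤ #B := by exact_mod_cast hB.card_pos
  have hr1 : 1 ≤ √(#B : ℝ) := Real.one_le_sqrt.2 hn1
  have hr2 : √(#B : ℝ) ^ 2 = #B := Real.sq_sqrt (by positivity)
  set r := √(#B : ℝ)
  obtain ⟨m, hm⟩ : ∃ m : ℕ, m = ⌈5 + 10 * r + 5 * y⌉₊ := ⟨_, rfl⟩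
  have hm1 : 5 + 10 * r + 5 * y ≤ m := hm ▸ Nat.le_ceil _
  have hm2 : (m : ℝ) < 5 + 10 * r + 5 * y + 1 := hm ▸ Nat.ceil_lt_add_one (by positivity)
  have hm5 : 5 ≤ m := by
    have : (5 : ℝ) ≤ m := by linarith
    exact_mod_cast this
  obtain ⟨p, hpp, hmp, hp2⟩ := Nat.exists_prime_lt_and_le_two_mul m (by omega)
  have hmp' : (m : ℝ) ≤ p := by exact_mod_cast hmp.le
  have hp2' : (p : ℝ) ≤ 2 * m := by exact_mod_cast hp2
  obtain ⟨S, hSB, hS, hSf, hSg⟩ := exists_sidonOn_of_prime hpp (by omega) (B := B) (f := f) (g := g)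
    (by
      have : (100 * #B : ℝ) ≤ p ^ 2 := by
        calc (100 * #B : ℝ) = (10 * r) ^ 2 := by rw [← hr2]; ring
          _ ≤ _ := by gcongr; linarith
      exact_mod_cast this) hf hg (by
      have : (100 * diffEnergy (B.image f) (B.image f) : ℝ) ≤ #B * p ^ 3 := by
        calc (100 * diffEnergy (B.image f) (B.image f) : ℝ) ≤ 100 * (#B * y ^ 3) := by gcongr
          _ ≤ 125 * (#B * y ^ 3) := by gcongr; norm_num
          _ = #B * (5 * y) ^ 3 := by ring
          _ ≤ _ := by gcongr; linarith
      exact_mod_cast this)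
  refine ⟨S, hSB, ?_, hSf, hSg⟩
  calc (#B : ℝ) ≤ 24 * p * #S := by exact_mod_cast hS
    _ ≤ 24 * (32 * (r + y)) * #S := by gcongr; linarith
    _ = _ := by ring

/-- Positive reals contain large sets that are Sidon for both addition and multiplication. -/
lemma exists_sidonOn_of_pos : ∃ K > (0 : ℝ), ∀ A : Finset ℝ, (∀ a ∈ A, 0 < a) → A.Nonempty →
    ∃ S ⊆ A, SidonOn id S ∧ SidonOn Real.log S ∧
      (#A : ℝ) ^ ((11 : ℝ) / 26) ≤ K * (1 + Real.log #A) ^ 3 * #S := by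
  obtain ⟨K₀, hK₀⟩ : ∃ K₀ : ℝ, K₀ = 2 ^ 140 * (2 * 686 ^ 12 * Real.exp 98) := ⟨_, rfl⟩
  have hK₀1 : 1 ≤ K₀ := by
    have := Real.one_le_exp (x := 98) (by norm_num)
    rw [hK₀]
    nlinarith
  refine ⟨768 * (2 + K₀), by positivity, fun A hA hne => ?_⟩
  obtain ⟨B, hBA, hNB, f, hf, hE⟩ := exists_subset_energy_le hA hne rfl rfl
  rw [← hK₀] at hE
  obtain ⟨N, hN⟩ : ∃ N : ℝ, N = (#A : ℝ) := ⟨_, rfl⟩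
  have hN1 : 1 ≤ N := by rw [hN]; exact_mod_cast hne.card_pos
  obtain ⟨l, hl⟩ : ∃ l, l = 1 + Real.log (#A : ℝ) := ⟨_, rfl⟩
  rw [← hl] at hE hNB ⊢
  rw [← hN] at hE hNB ⊢
  have hl1 : 1 ≤ l := by
    have := Real.log_nonneg (hN ▸ hN1)
    linarith
  have hB : B.Nonempty := by
    rw [nonempty_iff_ne_empty]
    rintro rfl
    simp at hNB
    linarith
  obtain ⟨n, hn⟩ : ∃ n : ℝ, n = (#B : ℝ) := ⟨_, rfl⟩
  have hn1 : 1 ≤ n := by rw [hn]; exact_mod_cast hB.card_pos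
  obtain ⟨E, hEE⟩ : ∃ E : ℝ, E = (diffEnergy (B.image f) (B.image f) : ℝ) := ⟨_, rfl⟩
  have hE0 : 0 ≤ E := by rw [hEE]; positivity
  rw [← hEE, ← hn] at hE
  rw [← hn] at hNB
  have hlog : Set.InjOn Real.log B := Real.log_injOn_pos.mono fun b hb => hA b (hBA hb)
  have hid : Set.InjOn (id : ℝ → ℝ) B := Function.injective_id.injOn
  obtain ⟨y, hy0, hy⟩ := exists_cube_root (x := E / n) (by positivity)
  have hEy : E = n * y ^ 3 := by rw [hy]; field_simp
  obtain ⟨S, hSB, hS, hSid, hSlog⟩ : ∃ S ⊆ B, n ≤ 768 * (√n + y) * #S ∧ SidonOn id S ∧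
      SidonOn Real.log S := by
    rw [hn] at hEy ⊢
    rcases hf with rfl | rfl
    · obtain ⟨S, h1, h2, h3, h4⟩ := exists_sidonOn_of_energy hB hid hlog hy0 (by rw [← hEE, hEy])
      exact ⟨S, h1, h2, h3, h4⟩
    · obtain ⟨S, h1, h2, h3, h4⟩ := exists_sidonOn_of_energy hB hlog hid hy0 (by rw [← hEE, hEy])
      exact ⟨S, h1, h2, h4, h3⟩
  refine ⟨S, hSB.trans hBA, hSid, hSlog, ?_⟩
  obtain ⟨z, hz⟩ : ∃ z, z = N ^ ((11 : ℝ) / 26) := ⟨_, rfl⟩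
  have hz0 : 0 ≤ z := by rw [hz]; positivity
  have hz78 : z ^ 78 = N ^ 33 := by
    rw [hz, ← Real.rpow_natCast, ← Real.rpow_mul (by linarith), ← Real.rpow_natCast]
    norm_num
  rw [← hz]
  have hyz : y * z ≤ K₀ * l ^ 3 * n := by
    refine le_of_pow_le_pow_left₀ (n := 78) (by norm_num) (by positivity) ?_
    refine le_of_mul_le_mul_left (a := n ^ 26) ?_ (by positivity)
    calc n ^ 26 * (y * z) ^ 78 = (n * y ^ 3) ^ 26 * z ^ 78 := by
          rw [mul_pow, mul_pow, ← pow_mul, ← mul_assoc]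
      _ ≤ K₀ * l ^ 160 * n ^ 104 := by rw [← hEy, hz78]; exact hE
      _ ≤ K₀ ^ 78 * l ^ 234 * n ^ 104 := by
          gcongr
          · exact le_self_pow₀ hK₀1 (by norm_num)
          · norm_num
      _ = n ^ 26 * (K₀ * l ^ 3 * n) ^ 78 := by
          rw [mul_pow, mul_pow, ← pow_mul, mul_left_comm, ← pow_add]
  have hrz : √n * z ≤ 2 * l ^ 3 * n := by
    have h1 : z ≤ √N := by
      rw [hz, Real.sqrt_eq_rpow]
      exact Real.rpow_le_rpow_of_exponent_le hN1 (by norm_num)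
    have h2 : √N ≤ 2 * l * √n := by
      refine Real.sqrt_le_iff.2 ⟨by positivity, ?_⟩
      rw [mul_pow, Real.sq_sqrt (by linarith)]
      calc N ≤ 2 * l * n := hNB
        _ ≤ (2 * l) ^ 2 * n := by gcongr; nlinarith
    calc √n * z ≤ √n * (2 * l * √n) := by gcongr; exact h1.trans h2
      _ = 2 * l * (√n * √n) := by ring
      _ = 2 * l * n := by rw [Real.mul_self_sqrt (by linarith)]
      _ ≤ 2 * l ^ 3 * n := by gcongr; exact le_self_pow₀ hl1 (by norm_num)
  refine le_of_mul_le_mul_left (a := n) ?_ (by linarith)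
  calc n * z ≤ 768 * (√n + y) * #S * z := mul_le_mul_of_nonneg_right hS hz0
    _ = 768 * #S * (√n * z + y * z) := by ring
    _ ≤ 768 * #S * (2 * l ^ 3 * n + K₀ * l ^ 3 * n) :=
        mul_le_mul_of_nonneg_left (add_le_add hrz hyz)
          (mul_nonneg (by norm_num) (Nat.cast_nonneg _))
    _ = _ := by ring

lemma SidonOn.isBiSidon {S : Finset ℝ} (hS : ∀ a ∈ S, 0 < a) (h : SidonOn id S)
    (h' : SidonOn Real.log S) : IsBiSidon (S : Set ℝ) := by
  have pair : ∀ {a b c d : ℝ}, a = c ∧ b = d ∨ a = d ∧ b = c → ({a, b} : Set ℝ) = {c, d} := by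
    rintro a b c d (⟨rfl, rfl⟩ | ⟨rfl, rfl⟩)
    · rfl
    · exact Set.pair_comm _ _
  refine ⟨fun a ha b hb c hc d hd hs => pair (h a ha b hb c hc d hd hs),
    fun a ha b hb c hc d hd hs => pair (h' a ha b hb c hc d hd ?_)⟩
  rw [← Real.log_mul (hS a ha).ne' (hS b hb).ne', ← Real.log_mul (hS c hc).ne' (hS d hd).ne', hs]

lemma IsBiSidon.image_neg {S : Finset ℝ} (h : IsBiSidon (S : Set ℝ)) :
    IsBiSidon ((S.image Neg.neg : Finset ℝ) : Set ℝ) := by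
  have pair : ∀ {a b c d : ℝ}, ({a, b} : Set ℝ) = {c, d} → ({-a, -b} : Set ℝ) = {-c, -d} := by
    intro a b c d h
    simpa [Set.image_pair] using congrArg (Set.image Neg.neg) h
  constructor <;> intro a ha b hb c hc d hd hs <;>
  · simp only [coe_image, Set.mem_image] at ha hb hc hd
    obtain ⟨a, ha, rfl⟩ := ha
    obtain ⟨b, hb, rfl⟩ := hb
    obtain ⟨c, hc, rfl⟩ := hc
    obtain ⟨d, hd, rfl⟩ := hd
    first
    | exact pair (h.1 a ha b hb c hc d hd (by linarith))
    | exact pair (h.2 a ha b hb c hc d hd (by linarith))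

theorem bi_sidon_real :
    ∃ c > (0 : ℝ), ∃ C ≥ (0 : ℝ), ∀ A : Finset ℝ, 2 ≤ A.card →
      ∃ S ⊆ A, IsBiSidon (S : Set ℝ) ∧
        c * (A.card : ℝ) ^ ((11 : ℝ) / 26) * (Real.log A.card) ^ (-C) ≤ S.card := by
  obtain ⟨K, hK, hpos⟩ := exists_sidonOn_of_pos
  have main : ∀ A A' : Finset ℝ, 2 ≤ #A → (∀ a ∈ A', 0 < a) → #A ≤ 4 * #A' → #A' ≤ #A →
      ∃ S ⊆ A', IsBiSidon (S : Set ℝ) ∧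
        1 / (108 * K) * (#A : ℝ) ^ ((11 : ℝ) / 26) * (Real.log #A) ^ (-(3 : ℝ)) ≤ #S := by
    intro A A' hA hA' h4 hle
    obtain ⟨S, hS, h1, h2, h3⟩ := hpos A' hA' (card_pos.1 (by omega))
    refine ⟨S, hS, h1.isBiSidon (fun a ha => hA' a (hS ha)) h2, ?_⟩
    have hA2 : (2 : ℝ) ≤ #A := by exact_mod_cast hA
    have hA1 : (1 : ℝ) ≤ #A' := by
      have : 1 ≤ #A' := by omega
      exact_mod_cast this
    have hlog : 1 / 2 ≤ Real.log #A :=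
      (by linarith [Real.log_two_gt_d9] : (1 : ℝ) / 2 ≤ Real.log 2).trans
        (Real.log_le_log (by norm_num) hA2)
    have hlog' : Real.log #A' ≤ Real.log #A :=
      Real.log_le_log (by linarith) (by exact_mod_cast hle)
    have hlog0 := Real.log_nonneg hA1
    have h5 : (#A : ℝ) ^ ((11 : ℝ) / 26) ≤ 4 * (#A' : ℝ) ^ ((11 : ℝ) / 26) := by
      calc (#A : ℝ) ^ ((11 : ℝ) / 26) ≤ (4 * #A' : ℝ) ^ ((11 : ℝ) / 26) := by
            gcongr; exact_mod_cast h4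
        _ = 4 ^ ((11 : ℝ) / 26) * (#A' : ℝ) ^ ((11 : ℝ) / 26) :=
            Real.mul_rpow (by norm_num) (by positivity)
        _ ≤ 4 * (#A' : ℝ) ^ ((11 : ℝ) / 26) := by
            gcongr
            exact (Real.rpow_le_rpow_of_exponent_le (by norm_num)
              (by norm_num : (11 : ℝ) / 26 ≤ 1)).trans_eq (Real.rpow_one 4)
    have h6 : (#A : ℝ) ^ ((11 : ℝ) / 26) ≤ 108 * K * #S * Real.log #A ^ 3 := by
      calc (#A : ℝ) ^ ((11 : ℝ) / 26) ≤ 4 * (K * (1 + Real.log #A') ^ 3 * #S) := by linarith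
        _ ≤ 4 * (K * (3 * Real.log #A) ^ 3 * #S) := by gcongr; linarith
        _ = _ := by ring
    have h7 : 0 < Real.log #A ^ 3 := by positivity
    rw [Real.rpow_neg (by linarith), show (3 : ℝ) = (3 : ℕ) by norm_num, Real.rpow_natCast,
      ← div_eq_mul_inv, div_le_iff₀ h7, div_mul_eq_mul_div, one_mul, div_le_iff₀ (by positivity)]
    linarith
  refine ⟨1 / (108 * K), by positivity, 3, by norm_num, fun A hA => ?_⟩
  have hsplit : #A ≤ #{a ∈ A | 0 < a} + #{a ∈ A | a < 0} + 1 := by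
    calc #A ≤ #(({a ∈ A | 0 < a} ∪ {a ∈ A | a < 0}) ∪ {0}) := by
          refine card_le_card fun a ha => ?_
          simp only [mem_union, mem_filter, mem_singleton, ha, true_and]
          rcases lt_trichotomy a 0 with h | h | h <;> simp [h]
      _ ≤ _ := (card_union_le _ _).trans
        (Nat.add_le_add (card_union_le _ _) (card_singleton _).le)
  rcases le_total (#{a ∈ A | a < 0}) (#{a ∈ A | 0 < a}) with h | h
  · obtain ⟨S, hS, h1, h2⟩ := main A {a ∈ A | 0 < a} hA (fun a ha => (mem_filter.1 ha).2)
      (by omega) (card_filter_le _ _)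
    exact ⟨S, hS.trans (filter_subset _ _), h1, h2⟩
  · have hcard : #({a ∈ A | a < 0}.image Neg.neg) = #{a ∈ A | a < 0} :=
      card_image_of_injective _ neg_injective
    obtain ⟨S, hS, h1, h2⟩ := main A ({a ∈ A | a < 0}.image Neg.neg) hA
      (fun a ha => by
        obtain ⟨b, hb, rfl⟩ := mem_image.1 ha
        exact neg_pos.2 (mem_filter.1 hb).2)
      (by omega) (hcard.trans_le (card_filter_le _ _))
    refine ⟨S.image Neg.neg, fun a ha => ?_, h1.image_neg, ?_⟩
    · obtain ⟨b, hb, rfl⟩ := mem_image.1 ha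
      obtain ⟨c, hc, rfl⟩ := mem_image.1 (hS hb)
      rw [neg_neg]
      exact (mem_filter.1 hc).1
    · rwa [card_image_of_injective _ neg_injective]
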